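/- arXiv:math/0703893 — 4 statements merged into one kernel-verified Lean document; each statement's English description precedes it below -/
import Mathlib

section
/- (i) For k = 1,…,N the limits 𝒯_{k,0} = lim_{u→∞} 𝒯_k(u) and 𝒯_{k,1} = lim_{u→∞} u(𝒯_k(u) − 𝒯_{k,0}) exist in End(M[m]), are scalar operators, and satisfy, for every x ∈ ℂ: x^N + Σ_{k=1}^N (−1)^k 𝒯_{k,0} x^{N−k} = ∏_{i=1}^N (x − K_i)·Id and Σ_{k=1}^N (−1)^k 𝒯_{k,1} x^{N−k} = − Σ_{j=1}^N m_j ∏_{i≠j} (x − K_i)·Id. (ii) For k = 1,…,N, the function T̃_k(u) := ∏_{s=1}^n (u − z_s)^k · 𝒯_k(u) is an End(M[m])-valued polynomial in u of degree at most nk; for each r ∈ {1,…,n} the operator c_{k,r} := T̃_k(z_r) ∏_{s≠r} (z_r − z_s)^{−k} is scalar, and, setting c_{0,r} = 1, for every d ∈ ℂ: Σ_{k=0}^N (−1)^k c_{k,r} ∏_{j=0}^{N−k−1} (d − j) = ∏_{i=1}^N (d − Λ^{(r)}_i − N + i). -/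
noncomputable section

namespace GaudinModel

/-- A vector-valued quasi-exponential: a finite sum of functions `e^{λu} p(u)` with `p` a
vector-valued polynomial. -/
def IsQE {M : Type*} [AddCommGroup M] [Module ℂ M] (f : ℂ → M) : Prop :=
  ∃ (k d : ℕ) (lam : Fin k → ℂ) (v : Fin k → Fin d → M),
    ∀ u : ℂ, f u = ∑ i : Fin k, ∑ j : Fin d,
      (Complex.exp (lam i * u) * u ^ (j : ℕ)) • v i j

variable {N n : ℕ}

/-- Points away from the singular points `z_1, …, z_n`. -/
def GoodG {n : ℕ} (z : Fin n → ℂ) (u : ℂ) : Prop := ∀ j : Fin n, u ≠ z j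

section Setup

variable (V : Fin n → Type*) [∀ i, AddCommGroup (V i)] [∀ i, Module ℂ (V i)]
  (M : Type*) [NormedAddCommGroup M] [NormedSpace ℂ M]
  (E : ∀ i : Fin n, Fin N → Fin N → (V i →ₗ[ℂ] V i))
  (φ : M ≃ₗ[ℂ] PiTensorProduct ℂ V)

/-- The commutation relations of `gl_N`: `[e_{ab}, e_{cd}] = δ_{bc} e_{ad} − δ_{da} e_{cb}`,
for the operators `E i a b` (the action of `e_{ab}` on the `i`-th factor `V i`). -/
def GlRel : Prop :=
  ∀ (i : Fin n) (a b c d : Fin N),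
    E i a b ∘ₗ E i c d - E i c d ∘ₗ E i a b =
      (if b = c then (1 : ℂ) else 0) • E i a d - (if d = a then (1 : ℂ) else 0) • E i c b

/-- Each `V i` is the irreducible finite-dimensional `gl_N`-module with highest weight
`Λ i`: it is generated by a nonzero vector `v` with `e_{ab} v = 0` for `a < b` and
`e_{aa} v = Λ_a v`. -/
def IsHW (Λ : Fin n → Fin N → ℤ) : Prop :=
  ∀ i : Fin n, ∃ v : V i, v ≠ 0 ∧
    (∀ a b : Fin N, a < b → E i a b v = 0) ∧
    (∀ a : Fin N, E i a a v = (Λ i a : ℂ) • v) ∧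
    ∀ W : Submodule ℂ (V i), (∀ a b : Fin N, ∀ x ∈ W, E i a b x ∈ W) → v ∈ W →
      ∀ x : V i, x ∈ W

/-- `e_{ab}` acting in the `j`-th tensor factor of `M ≃ V 1 ⊗ ⋯ ⊗ V n`. -/
def EE (j : Fin n) (a b : Fin N) : Module.End ℂ M :=
  φ.symm.toLinearMap ∘ₗ
    (PiTensorProduct.map
      (Function.update (fun i : Fin n => (LinearMap.id : V i →ₗ[ℂ] V i)) j (E j a b))) ∘ₗ
    φ.toLinearMap

variable (z : Fin n → ℂ) (K : Matrix (Fin N) (Fin N) ℂ)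

/-- `X_{ab}(u,∂) = δ_{ab} ∂ − K_{ab} − ∑_j e_{ba}^{(j)}/(u − z_j)`,
acting on `M`-valued functions. -/
def Xg (a b : Fin N) (f : ℂ → M) : ℂ → M :=
  fun u => (if a = b then deriv f u else 0) - K a b • f u
    - ∑ j : Fin n, (u - z j)⁻¹ • (EE V M E φ j b a) (f u)

/-- The universal differential operator
`D_{K,M}(u,∂) = ∑_{σ ∈ S_N} sgn(σ) X_{1σ(1)}(u,∂) ⋯ X_{Nσ(N)}(u,∂)`. -/
def Dg (f : ℂ → M) : ℂ → M :=
  fun u => ∑ σ : Equiv.Perm (Fin N),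
    ((Equiv.Perm.sign σ : ℤˣ) : ℤ) •
      (((List.ofFn fun a : Fin N => Xg V M E φ z K a (σ a)).foldr (· ∘ ·) id) f u)

/-- The weight subspace `M[m]`. -/
def Wt (m : Fin N → ℤ) : Submodule ℂ M :=
  ⨅ a : Fin N, LinearMap.ker
    ((∑ j : Fin n, EE V M E φ j a a) - (m a : ℂ) • (1 : Module.End ℂ M))

/-- The subspace `sing M[m]` of `gl_N`-singular vectors of weight `m`. -/
def SingWt (m : Fin N → ℤ) : Submodule ℂ M :=
  Wt V M E φ m ⊓ ⨅ a : Fin N, ⨅ b : Fin N, ⨅ _ : a < b,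
    LinearMap.ker (∑ j : Fin n, EE V M E φ j a b)

end Setup

end GaudinModel

set_option linter.unusedSectionVars false
namespace GaudinModel

section Capelli
variable {R : Type*} [Ring R] [Algebra ℂ R]

lemma prod_split : ∀ (l : ℕ) (j : Fin l), ∃ A B : (Fin (l+1) → R) → R,
    (∀ g, (List.ofFn g).prod = A g * (g j.castSucc * g j.succ) * B g) ∧
    (∀ g g', (∀ i, i ≠ j.castSucc → i ≠ j.succ → g i = g' i) → A g = A g' ∧ B g = B g') := by
  intro l
  induction l with
  | zero => intro j; exact j.elim0
  | succ l ih =>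
    intro j
    refine Fin.cases ?_ (fun j => ?_) j
    · refine ⟨fun _ => 1, fun g => (List.ofFn fun i : Fin l => g i.succ.succ).prod, ?_, ?_⟩
      · intro g
        simp [List.ofFn_succ, mul_assoc]
      · intro g g' h
        refine ⟨rfl, ?_⟩
        have : (fun i : Fin l => g i.succ.succ) = fun i : Fin l => g' i.succ.succ := by
          funext i
          apply h
          · simp
          · simp [Fin.ext_iff]
        simp only [this]
    · obtain ⟨A, B, h1, h2⟩ := ih j
      refine ⟨fun g => g 0 * A (fun i => g i.succ), fun g => B (fun i => g i.succ), ?_, ?_⟩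
      · intro g
        rw [List.ofFn_succ, List.prod_cons, h1]
        simp [mul_assoc]
      · intro g g' h
        have h0 : g 0 = g' 0 := h 0 (by simp [Fin.ext_iff]) (by simp [Fin.ext_iff])
        have := h2 (fun i => g i.succ) (fun i => g' i.succ) (by
          intro i hi hi'
          apply h
          · intro hh; apply hi; simpa [Fin.ext_iff] using hh
          · intro hh; apply hi'; simpa [Fin.ext_iff] using hh)
        simp [h0, this]

lemma comm_prod : ∀ (l : ℕ) (x : R) (g : Fin l → R),
    x * (List.ofFn g).prod - (List.ofFn g).prod * x =
      ∑ i, (List.ofFn (Function.update g i (x * g i - g i * x))).prod := by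
  intro l
  induction l with
  | zero => intro x g; simp
  | succ l ih =>
    intro x g
    rw [Fin.sum_univ_succ]
    have h1 : ∀ (i : Fin l) y, (fun k : Fin l => Function.update g i.succ y k.succ) =
        Function.update (fun k => g k.succ) i y := by
      intro i y
      funext k
      by_cases h : k = i
      · subst h; simp
      · simp [h]
    have h2 : ∀ y, (fun k : Fin l => Function.update g 0 y k.succ) = fun k => g k.succ := by
      intro y; funext k; simp
    simp only [List.ofFn_succ, List.prod_cons, h1, h2, Function.update_self]
    have h3 : ∀ (i : Fin l) y, Function.update g i.succ y 0 = g 0 := by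
      intro i y; simp [Function.update_of_ne, (Fin.succ_ne_zero i).symm]
    simp only [h3]
    rw [← Finset.mul_sum, ← ih]
    noncomm_ring

variable {N : ℕ} (e : Fin N → Fin N → R)

def XX (s : ℂ) (a b : Fin N) : R := (if a = b then s else 0) • (1 : R) - e b a

def FF {l : ℕ} (s : Fin l → ℂ) (ρ : Fin l → Fin N) (c : Equiv.Perm (Fin l) → Fin l → Fin N) : R :=
  ∑ σ : Equiv.Perm (Fin l), ((Equiv.Perm.sign σ : ℤˣ) : ℤ) •
    (List.ofFn fun i => XX e (s i) (ρ i) (c σ i)).prod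

def GR : Prop := ∀ a b c d : Fin N, e a b * e c d - e c d * e a b =
      (if b = c then (1 : ℂ) else 0) • e a d - (if d = a then (1 : ℂ) else 0) • e c b

variable {e}

lemma XX_rel (he : GR e) (s : ℂ) (a a' b b' : Fin N) :
    XX e (s-1) a b * XX e s a' b' + XX e (s-1) a' b * XX e s a b'
      = XX e (s-1) a b' * XX e s a' b + XX e (s-1) a' b' * XX e s a b := by
  have h1 := he b a b' a'
  have h2 := he b a' b' a
  simp only [XX, sub_mul, mul_sub, smul_mul_assoc, mul_smul_comm, one_mul, mul_one]
  rw [sub_eq_iff_eq_add] at h1 h2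
  rw [h1, h2]
  have d1 : ∀ (a b : Fin N) (s : ℂ), (if a = b then s else 0) = s * (if a = b then 1 else 0) := by
    intros; split_ifs <;> simp
  simp only [d1 _ _ s, d1 _ _ (s-1)]
  module

lemma sum_half {l : ℕ} (h : Equiv.Perm (Fin l) → R) (τ : Equiv.Perm (Fin l))
    (hh : ∀ σ, h σ + h (σ * τ) = 0) : ∑ σ, h σ = 0 := by
  have h1 : ∑ σ, h (σ * τ) = ∑ σ, h σ := Equiv.sum_comp (Equiv.mulRight τ) h
  have h2 : ∑ σ, h σ + ∑ σ, h σ = 0 := by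
    nth_rw 2 [← h1]
    rw [← Finset.sum_add_distrib]
    exact Finset.sum_eq_zero fun σ _ => hh σ
  have h3 : (2:ℂ) • ∑ σ, h σ = 0 := by rw [two_smul]; exact h2
  have := congrArg (fun x => (2⁻¹:ℂ) • x) h3
  simpa [smul_smul] using this

lemma sum_half' {l : ℕ} (h : Equiv.Perm (Fin l) → R) (τ : Equiv.Perm (Fin l))
    (hh : ∀ σ, h σ + h (τ * σ) = 0) : ∑ σ, h σ = 0 := by
  have h1 : ∑ σ, h (τ * σ) = ∑ σ, h σ := Equiv.sum_comp (Equiv.mulLeft τ) h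
  have h2 : ∑ σ, h σ + ∑ σ, h σ = 0 := by
    nth_rw 2 [← h1]
    rw [← Finset.sum_add_distrib]
    exact Finset.sum_eq_zero fun σ _ => hh σ
  have h3 : (2:ℂ) • ∑ σ, h σ = 0 := by rw [two_smul]; exact h2
  have := congrArg (fun x => (2⁻¹:ℂ) • x) h3
  simpa [smul_smul] using this

abbrev FC (e : Fin N → Fin N → R) {l : ℕ} (s : Fin l → ℂ) (κ : Fin l → Fin N)
   (ρ : Fin l → Fin N) : R := FF e s ρ (fun σ i => κ (σ i))

lemma FC_adj (he : GR e) {l : ℕ} (s : Fin (l+1) → ℂ) (κ : Fin (l+1) → Fin N)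
    (ρ : Fin (l+1) → Fin N) (j : Fin l) (hs : s j.castSucc = s j.succ - 1) :
    FC e s κ (ρ ∘ Equiv.swap j.castSucc j.succ) = - FC e s κ ρ := by
  rw [eq_neg_iff_add_eq_zero]
  unfold FC FF
  rw [← Finset.sum_add_distrib]
  obtain ⟨A, B, h1, h2⟩ := prod_split (R := R) l j
  have hne : j.castSucc ≠ j.succ := by simp [Fin.ext_iff]
  apply sum_half _ (Equiv.swap j.castSucc j.succ)
  intro σ
  set τ := Equiv.swap j.castSucc j.succ with hτ
  have hsg : ((Equiv.Perm.sign (σ * τ) : ℤˣ) : ℤ) = - ((Equiv.Perm.sign σ : ℤˣ) : ℤ) := by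
    simp [hτ, Equiv.Perm.sign_swap hne]
  simp only [h1]
  rw [hsg]
  have k1 : τ j.castSucc = j.succ := by simp [hτ]
  have k2 : τ j.succ = j.castSucc := by simp [hτ]
  have k3 : ∀ i, i ≠ j.castSucc → i ≠ j.succ → τ i = i := by
    intro i hi hi'; exact Equiv.swap_apply_of_ne_of_ne hi hi'
  obtain ⟨a1, b1⟩ := h2 (fun i => XX e (s i) ((ρ ∘ τ) i) (κ (σ i))) (fun i => XX e (s i) (ρ i) (κ (σ i)))
    (by intro i hi hi'; simp [k3 i hi hi'])
  obtain ⟨a2, b2⟩ := h2 (fun i => XX e (s i) ((ρ ∘ τ) i) (κ ((σ * τ) i))) (fun i => XX e (s i) (ρ i) (κ (σ i)))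
    (by intro i hi hi'; simp [k3 i hi hi'])
  obtain ⟨a3, b3⟩ := h2 (fun i => XX e (s i) (ρ i) (κ ((σ * τ) i))) (fun i => XX e (s i) (ρ i) (κ (σ i)))
    (by intro i hi hi'; simp [k3 i hi hi'])
  rw [a1, b1, a2, b2, a3, b3]
  simp only [Function.comp, Equiv.Perm.mul_apply, k1, k2, hs]
  have := XX_rel he (s j.succ) (ρ j.castSucc) (ρ j.succ) (κ (σ j.castSucc)) (κ (σ j.succ))
  rw [neg_smul, neg_smul, ← smul_add, ← neg_add, ← smul_add, ← add_mul, ← mul_add, ← add_mul, ← mul_add,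
    add_comm (XX e (s j.succ - 1) (ρ j.succ) (κ (σ j.castSucc)) * _), this, add_comm (_ * _) (_ * _),
    add_neg_cancel]

lemma FC_perm (he : GR e) {l : ℕ} (s : Fin (l+1) → ℂ) (κ : Fin (l+1) → Fin N)
    (hs : ∀ j : Fin l, s j.castSucc = s j.succ - 1) (τ : Equiv.Perm (Fin (l+1))) :
    ∀ (ρ : Fin (l+1) → Fin N),
    FC e s κ (ρ ∘ τ) = ((Equiv.Perm.sign τ : ℤˣ) : ℤ) • FC e s κ ρ := by
  have hτ : τ ∈ Submonoid.closure (Set.range fun i : Fin l ↦ Equiv.swap i.castSucc i.succ) := by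
    rw [Equiv.Perm.mclosure_swap_castSucc_succ]; trivial
  induction hτ using Submonoid.closure_induction with
  | mem x hx =>
    obtain ⟨j, rfl⟩ := hx
    intro ρ
    have hne : j.castSucc ≠ j.succ := by simp [Fin.ext_iff]
    simp [FC_adj he s κ ρ j (hs j), Equiv.Perm.sign_swap hne]
  | one => intro ρ; simp
  | mul x y _ _ hx hy =>
    intro ρ
    rw [Equiv.Perm.coe_mul, ← Function.comp_assoc, hy, hx, smul_smul]
    simp [mul_comm]

lemma self_neg {x : R} (h : x = -x) : x = 0 := by
  have h3 : (2:ℂ) • x = 0 := by rw [two_smul]; nth_rw 2 [h]; simp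
  have := congrArg (fun x => (2⁻¹:ℂ) • x) h3
  simpa [smul_smul] using this

lemma FC_rep (he : GR e) {l : ℕ} (s : Fin (l+1) → ℂ) (κ : Fin (l+1) → Fin N)
    (hs : ∀ j : Fin l, s j.castSucc = s j.succ - 1) (ρ : Fin (l+1) → Fin N) (c d : Fin (l+1))
    (hcd : c ≠ d) (h : ρ c = ρ d) : FC e s κ ρ = 0 := by
  have h1 := FC_perm he s κ hs (Equiv.swap c d) ρ
  have h2 : ρ ∘ Equiv.swap c d = ρ := by
    funext i
    simp only [Function.comp, Equiv.swap_apply_def]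
    split_ifs with h3 h4
    · rw [h3, h]
    · rw [h4, h]
    · rfl
  rw [h2] at h1
  simp only [Equiv.Perm.sign_swap hcd, Units.val_neg, Units.val_one, neg_smul, one_smul] at h1
  exact self_neg h1

lemma comm_XX (he : GR e) (c d : Fin N) (s : ℂ) (a b : Fin N) :
    e c d * XX e s a b - XX e s a b * e c d =
      (if d = b then (1:ℂ) else 0) • XX e s a c - (if a = c then (1:ℂ) else 0) • XX e s d b := by
  have h1 := he c d b a
  simp only [XX, sub_mul, mul_sub, smul_mul_assoc, mul_smul_comm, one_mul, mul_one]
  rw [sub_eq_iff_eq_add] at h1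
  rw [h1]
  have d1 : ∀ (a b : Fin N) (s : ℂ), (if a = b then s else 0) = s * (if a = b then 1 else 0) := by
    intros; split_ifs <;> simp
  simp only [d1 _ _ s]
  have : (if d = b then (1:ℂ) else 0) * (s * if a = c then 1 else 0) =
     (if a = c then (1:ℂ) else 0) * (s * if d = b then 1 else 0) := by ring
  have h2 : (if a = c then (1:ℂ) else 0) = if a = c then 1 else 0 := rfl
  generalize (if d = b then (1:ℂ) else 0) = x
  generalize (if a = c then (1:ℂ) else 0) = y
  module

/-- Centrality of the Capelli determinant. -/
lemma capelli_central {e : Fin N → Fin N → R} (he : GR e) (s : Fin N → ℂ)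
    (hs : ∀ i j : Fin N, (j : ℕ) = i + 1 → s i = s j - 1) (c d : Fin N) :
    e c d * FC e s id id = FC e s id id * e c d := by
  obtain ⟨l, rfl⟩ : ∃ l, N = l + 1 := ⟨N - 1, by have := c.pos; omega⟩
  have hs' : ∀ j : Fin l, s j.castSucc = s j.succ - 1 := fun j => hs _ _ (by simp)
  rw [← sub_eq_zero]
  set r : Fin (l+1) → Fin (l+1) := Function.update id d c with hr
  set ρ : Fin (l+1) → Fin (l+1) := Function.update id c d with hρ
  have main : e c d * FC e s id id - FC e s id id * e c d = FC e s r id - FC e s id ρ := by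
    unfold FC FF
    rw [Finset.mul_sum, Finset.sum_mul, ← Finset.sum_sub_distrib, ← Finset.sum_sub_distrib]
    apply Finset.sum_congr rfl
    intro σ _
    rw [mul_smul_comm, smul_mul_assoc, ← smul_sub, ← smul_sub, comm_prod]
    congr 1
    have key : ∀ i : Fin (l+1), (List.ofFn (Function.update (fun i => XX e (s i) (id i) (id (σ i))) i
        (e c d * XX e (s i) (id i) (id (σ i)) - XX e (s i) (id i) (id (σ i)) * e c d))).prod =
        (if i = σ.symm d then (List.ofFn fun i => XX e (s i) (id i) (r (σ i))).prod else 0) -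
        (if i = c then (List.ofFn fun i => XX e (s i) (ρ i) (id (σ i))).prod else 0) := by
      intro i
      have := fun g => MultilinearMap.mkPiAlgebraFin_apply (R := ℂ) (n := l+1) (A := R) g
      simp only [← this]
      rw [comm_XX he, MultilinearMap.map_update_sub, MultilinearMap.map_update_smul,
        MultilinearMap.map_update_smul]
      congr 1
      · by_cases h : i = σ.symm d
        · subst h
          simp only [id, Equiv.apply_symm_apply, if_true, one_smul]
          congr 1
          funext k
          by_cases hk : k = σ.symm d
          · subst hk; simp [hr]
          · have : σ k ≠ d := fun h => hk (by simp [← h])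
            simp [hr, hk, this]
        · have : d ≠ σ i := fun h' => h (by simp [h'])
          simp [h, this]
      · by_cases h : i = c
        · subst h
          simp only [id, if_true, one_smul]
          congr 1
          funext k
          by_cases hk : k = i
          · subst hk; simp [hρ]
          · simp [hρ, hk]
        · simp [h]
    rw [Finset.sum_congr rfl (fun i _ => key i), Finset.sum_sub_distrib]
    simp
  rw [main]
  by_cases hcd : c = d
  · subst hcd
    have h0 : Function.update (id : Fin (l+1) → Fin (l+1)) c c = id := Function.update_eq_self c id
    rw [hr, hρ, h0, sub_self]
  · have h1 : FC e s id ρ = 0 := FC_rep he s id hs' ρ c d hcd (by simp [hρ, Ne.symm hcd])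
    have h2 : FC e s r id = 0 := by
      unfold FC FF
      apply sum_half' _ (Equiv.swap c d)
      intro σ
      have : ∀ x, r (Equiv.swap c d x) = r x := by
        intro x
        simp only [hr, Function.update_apply, Equiv.swap_apply_def, id]
        split_ifs <;> simp_all
      simp [this, Equiv.Perm.sign_swap hcd]
    rw [h1, h2, sub_zero]

lemma capelli_hw {V : Type*} [AddCommGroup V] [Module ℂ V] {N : ℕ}
    (e : Fin N → Fin N → Module.End ℂ V) (s lam : Fin N → ℂ) (v : V)
    (h1 : ∀ a b : Fin N, a < b → e a b v = 0) (h2 : ∀ a, e a a v = lam a • v) :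
    FC e s id id v = (∏ i, (s i - lam i)) • v := by
  have key : ∀ (l : ℕ) (ρ σ : Fin l → Fin N), (∀ i, ρ i = σ i) →
      (List.ofFn fun i => XX e (s (ρ i)) (ρ i) (σ i)).prod v =
        (∏ i, (s (ρ i) - lam (ρ i))) • v := by
    intro l
    induction l with
    | zero => intro ρ σ h; simp
    | succ l ih =>
      intro ρ σ h
      rw [List.ofFn_succ, List.prod_cons, Module.End.mul_apply,
        ih (fun i => ρ i.succ) (fun i => σ i.succ) (fun i => h _), Fin.prod_univ_succ, map_smul]
      simp only [← h 0, XX]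
      simp [h2, ← sub_smul, smul_smul, mul_comm]
  have key0 : ∀ (l : ℕ) (ρ σ : Fin l → Fin N), (∀ i, (∀ j, i < j → σ j = ρ j) → σ i ≤ ρ i) →
      (∃ i, ρ i ≠ σ i) →
      (List.ofFn fun i => XX e (s (ρ i)) (ρ i) (σ i)).prod v = 0 := by
    intro l
    induction l with
    | zero => rintro ρ σ h ⟨i, _⟩; exact i.elim0
    | succ l ih =>
      intro ρ σ h hne
      rw [List.ofFn_succ, List.prod_cons, Module.End.mul_apply]
      by_cases ht : ∃ i : Fin l, ρ i.succ ≠ σ i.succ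
      · rw [ih (fun i => ρ i.succ) (fun i => σ i.succ) ?_ ht, map_zero]
        intro i hi
        apply h
        intro j hj
        obtain ⟨k, rfl⟩ := Fin.exists_succ_eq.mpr (show j ≠ 0 from fun h0 => by simp [h0] at hj)
        exact hi k (by simpa using hj)
      · push Not at ht
        rw [key l (fun i => ρ i.succ) (fun i => σ i.succ) ht, map_smul]
        have h0 : ρ 0 ≠ σ 0 := by
          obtain ⟨i, hi⟩ := hne
          revert hi
          refine Fin.cases (fun h => h) (fun i hi => absurd (ht i) hi) i
        have hlt : σ 0 < ρ 0 := by
          refine lt_of_le_of_ne (h 0 ?_) h0.symm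
          intro j hj
          obtain ⟨k, rfl⟩ := Fin.exists_succ_eq.mpr (show j ≠ 0 from fun h0 => by simp [h0] at hj)
          exact (ht k).symm
        simp [XX, h0, h1 _ _ hlt]
  unfold FC FF
  rw [LinearMap.sum_apply, Finset.sum_eq_single 1]
  · have := key N id id (fun _ => rfl)
    simpa using this
  · intro σ _ hσ
    rw [LinearMap.smul_apply]
    have hz : (List.ofFn fun i => XX e (s (id i)) (id i) (σ i)).prod v = 0 := by
      apply key0 N id σ
      · intro i hi
        by_contra hlt
        push Not at hlt
        have := hi (σ i) hlt
        have h3 := σ.injective this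
        simp only [id] at hlt h3
        rw [h3] at hlt
        exact lt_irrefl _ hlt
      · by_contra hcon
        push Not at hcon
        exact hσ (Equiv.ext fun i => by simpa using (hcon i).symm)
    simp only [id] at hz ⊢
    rw [hz, smul_zero]
  · simp

end Capelli

section Alg
open Polynomial
attribute [local instance] Polynomial.algebra
variable {A : Type*} [Ring A] [Algebra ℂ A]

def Qc {n : ℕ} (z : Fin n → ℂ) : ℂ[X] := ∏ s, (X - C (z s))
def Qj {n : ℕ} (z : Fin n → ℂ) (j : Fin n) : ℂ[X] := ∏ s ∈ Finset.univ.erase j, (X - C (z s))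

lemma Qc_eq {n : ℕ} (z : Fin n → ℂ) (j : Fin n) : Qc z = (X - C (z j)) * Qj z j := by
  unfold Qc Qj
  exact (Finset.mul_prod_erase _ (fun s => X - C (z s)) (Finset.mem_univ j)).symm

lemma Qc_deg {n : ℕ} (z : Fin n → ℂ) : (Qc z).natDegree = n := by
  unfold Qc
  simp

lemma Qj_deg {n : ℕ} (z : Fin n → ℂ) (j : Fin n) : (Qj z j).natDegree = n - 1 := by
  unfold Qj
  rw [natDegree_prod_of_monic _ _ (fun i _ => monic_X_sub_C _)]
  simp

lemma Qc_eval {n : ℕ} (z : Fin n → ℂ) (u : ℂ) : (Qc z).eval u = ∏ s, (u - z s) := by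
  simp [Qc, eval_prod]

lemma Qj_eval {n : ℕ} (z : Fin n → ℂ) (j : Fin n) (u : ℂ) :
    (Qj z j).eval u = ∏ s ∈ Finset.univ.erase j, (u - z s) := by
  simp [Qj, eval_prod]

lemma Qj_eval_ne {n : ℕ} (z : Fin n → ℂ) (j r : Fin n) (h : j ≠ r) :
    (Qj z j).eval (z r) = 0 := by
  rw [Qj_eval]
  exact Finset.prod_eq_zero (i := r) (by simp [h.symm]) (by simp)

lemma Qc_eval_self {n : ℕ} (z : Fin n → ℂ) (r : Fin n) : (Qc z).eval (z r) = 0 := by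
  rw [Qc_eq z r]; simp

lemma Qc_deriv_eval {n : ℕ} (z : Fin n → ℂ) (r : Fin n) :
    (derivative (Qc z)).eval (z r) = (Qj z r).eval (z r) := by
  rw [Qc_eq z r]; simp

/-- Evaluation at a scalar, as a ring homomorphism. -/
def ev (u : ℂ) : A[X] →+* A :=
  eval₂RingHom' (RingHom.id A) (u • (1 : A)) (fun a => by
    change a * _ = _ * a
    simp)

lemma ev_apply (u : ℂ) (P : A[X]) : ev u P = P.eval (u • (1 : A)) := rfl

lemma ev_C (u : ℂ) (a : A) : ev u (C a) = a := by simp [ev_apply]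
lemma ev_X (u : ℂ) : ev u (X : A[X]) = u • 1 := by simp [ev_apply]

lemma smul_def' (q : ℂ[X]) (P : A[X]) : q • P = q.map (algebraMap ℂ A) * P := rfl

lemma ev_smul (u : ℂ) (q : ℂ[X]) (P : A[X]) : ev u (q • P) = q.eval u • ev u P := by
  rw [smul_def', map_mul]
  have : ev u (q.map (algebraMap ℂ A)) = algebraMap ℂ A (q.eval u) := by
    have h : u • (1 : A) = algebraMap ℂ A u := by rw [Algebra.algebraMap_eq_smul_one]
    rw [ev_apply, h, eval_map_apply]
  rw [this, Algebra.smul_def]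

lemma X_smul (P : A[X]) : (X : ℂ[X]) • P = X * P := by simp [smul_def']
lemma C_smul (c : ℂ) (P : A[X]) : (C c : ℂ[X]) • P = C (algebraMap ℂ A c) * P := by
  simp [smul_def']

lemma deriv_smul (q : ℂ[X]) (P : A[X]) :
    derivative (q • P) = derivative q • P + q • derivative P := by
  simp [smul_def', derivative_mul, derivative_map]

lemma smul_deg_lt {q : ℂ[X]} {P : A[X]} {a b c : ℕ} (hq : q.natDegree ≤ a)
    (hP : P.degree < (b : WithBot ℕ)) (hc : a + b ≤ c) : (q • P).degree < (c : WithBot ℕ) := by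
  rw [smul_def']
  by_cases h0 : P = 0
  · rw [h0, mul_zero, degree_zero]; exact WithBot.bot_lt_coe _
  have h1 : (q.map (algebraMap ℂ A)).degree ≤ (a : WithBot ℕ) :=
    degree_map_le.trans (degree_le_of_natDegree_le hq)
  have h2 : P.natDegree < b := (natDegree_lt_iff_degree_lt h0).mpr hP
  refine lt_of_le_of_lt (b := ((a + P.natDegree : ℕ) : WithBot ℕ)) ?_ (by exact_mod_cast by omega)
  refine (degree_mul_le _ _).trans ?_
  push_cast
  exact add_le_add h1 degree_le_natDegree

lemma C_mul_deg_lt {P : A[X]} {b : ℕ} (x : A)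
    (hP : P.degree < (b : WithBot ℕ)) : (C x * P).degree < (b : WithBot ℕ) := by
  rw [degree_lt_iff_coeff_zero] at *
  intro m hm
  rw [coeff_C_mul, hP m hm, mul_zero]

lemma X_deriv_deg_lt {P : A[X]} {b : ℕ}
    (hP : P.degree < (b : WithBot ℕ)) : ((X : ℂ[X]) • derivative P).degree < (b : WithBot ℕ) := by
  rw [degree_lt_iff_coeff_zero] at *
  intro m hm
  rw [X_smul]
  cases m with
  | zero => simp
  | succ m => rw [coeff_X_mul, coeff_derivative, hP _ hm, zero_mul]

lemma X_cancel_deg {P : A[X]} {b : ℕ}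
    (hP : ((X : ℂ[X]) • P).degree < ((b + 1 : ℕ) : WithBot ℕ)) : P.degree < (b : WithBot ℕ) := by
  rw [degree_lt_iff_coeff_zero] at *
  intro m hm
  have := hP (m+1) (by omega)
  rwa [X_smul, coeff_X_mul] at this

lemma C_deg_lt (x : A) : (C x : A[X]).degree < ((1 : ℕ) : WithBot ℕ) := by
  rw [degree_lt_iff_coeff_zero]
  intro m hm
  rw [coeff_C, if_neg (by omega)]

variable {n N : ℕ}

/-- `P / Q^k = α + γ / u + o(1/u)` at infinity. -/
def AtInf (z : Fin n → ℂ) (k : ℕ) (P : A[X]) (α γ : A) : Prop :=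
  ((X : ℂ[X]) • P - (Qc z ^ k * X) • (C α : A[X]) - (Qc z ^ k) • (C γ : A[X])).degree
    < ((n * k : ℕ) : WithBot ℕ)

variable {z : Fin n → ℂ} {k : ℕ}

lemma AtInf.add {P P' : A[X]} {α α' γ γ' : A} (h : AtInf z k P α γ) (h' : AtInf z k P' α' γ') :
    AtInf z k (P + P') (α + α') (γ + γ') := by
  unfold AtInf at *
  refine lt_of_eq_of_lt ?_ (lt_of_le_of_lt (degree_add_le _ _) (max_lt h h'))
  congr 1
  rw [C_add, C_add]
  module

lemma AtInf.zero : AtInf z k (0 : A[X]) 0 0 := by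
  unfold AtInf
  rw [C_0, smul_zero, smul_zero, smul_zero, sub_zero, sub_zero, degree_zero]
  exact WithBot.bot_lt_coe _

lemma AtInf.smul {P : A[X]} {α γ : A} (h : AtInf z k P α γ) (c : ℂ) :
    AtInf z k ((C c : ℂ[X]) • P) (c • α) (c • γ) := by
  unfold AtInf at *
  refine lt_of_eq_of_lt ?_ (smul_deg_lt (q := C c) (a := 0) (by simp) h (by simp))
  congr 1
  have : ∀ x : A, (C (c • x) : A[X]) = (C c : ℂ[X]) • (C x : A[X]) := by
    intro x; rw [C_smul, ← C_mul, Algebra.smul_def]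
  rw [this, this]
  module

lemma AtInf.neg {P : A[X]} {α γ : A} (h : AtInf z k P α γ) :
    AtInf z k (-P) (-α) (-γ) := by
  have := h.smul (-1)
  simpa using this

lemma AtInf.sub {P P' : A[X]} {α α' γ γ' : A} (h : AtInf z k P α γ) (h' : AtInf z k P' α' γ') :
    AtInf z k (P - P') (α - α') (γ - γ') := by
  simpa [sub_eq_add_neg] using h.add h'.neg

lemma AtInf.sum {ι : Type*} (s : Finset ι) {P : ι → A[X]} {α γ : ι → A}
    (h : ∀ i ∈ s, AtInf z k (P i) (α i) (γ i)) :
    AtInf z k (∑ i ∈ s, P i) (∑ i ∈ s, α i) (∑ i ∈ s, γ i) := by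
  classical
  induction s using Finset.induction_on with
  | empty => simpa using AtInf.zero
  | insert a s ha ih =>
    rw [Finset.sum_insert ha, Finset.sum_insert ha, Finset.sum_insert ha]
    exact (h a (by simp)).add (ih fun i hi => h i (by simp [hi]))

lemma AtInf.mulQ {P : A[X]} {α γ : A} (h : AtInf z k P α γ) :
    AtInf z (k+1) (Qc z • P) α γ := by
  unfold AtInf at *
  refine lt_of_eq_of_lt ?_ (smul_deg_lt (q := Qc z) (a := n) (c := n * (k+1)) (Qc_deg z).le h (by ring_nf; rfl))
  congr 1
  module

lemma AtInf.deriv (hn : 1 ≤ n) {P : A[X]} {α γ : A} (h : AtInf z k P α γ) :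
    AtInf z (k+1) (Qc z • derivative P - ((k : ℂ[X]) * derivative (Qc z)) • P) 0 0 := by
  unfold AtInf at *
  set R := ((X : ℂ[X]) • P - (Qc z ^ k * X) • (C α : A[X]) - (Qc z ^ k) • (C γ : A[X])) with hR
  rw [C_0, smul_zero, smul_zero, sub_zero, sub_zero]
  apply X_cancel_deg
  have key : (X : ℂ[X]) • (X : ℂ[X]) • (Qc z • derivative P - ((k : ℂ[X]) * derivative (Qc z)) • P) =
     Qc z • ((X : ℂ[X]) • derivative R) - (Qc z ^ (k+1)) • C γ - Qc z • R
       - ((k : ℂ[X]) * (X * derivative (Qc z))) • R := by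
    rw [hR]
    simp only [derivative_sub, deriv_smul, derivative_X, derivative_C, derivative_mul, derivative_pow]
    rcases k with _ | k
    · simp
      module
    · simp only [Nat.add_sub_cancel]
      push_cast
      simp only [map_add, map_natCast, map_one]
      module
  rw [key]
  have e1 : n + n * k ≤ n * (k+1) := by ring_nf; rfl
  have e0 : n + n * k ≤ n * (k+1) + 1 := by omega
  have d1 := smul_deg_lt (q := Qc z) (Qc_deg z).le (X_deriv_deg_lt h) e0
  have d2 := smul_deg_lt (q := Qc z ^ (k+1)) (a := n * (k+1)) (c := n * (k+1) + 1)
    (by rw [natDegree_pow, Qc_deg, mul_comm]) (C_deg_lt γ) le_rfl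
  have d3 := smul_deg_lt (q := Qc z) (Qc_deg z).le h e0
  have d4 := smul_deg_lt (q := (k : ℂ[X]) * (X * derivative (Qc z))) (a := n) (P := R) (by
    refine natDegree_mul_le.trans ?_
    rw [natDegree_natCast, zero_add]
    refine natDegree_mul_le.trans ?_
    have := natDegree_derivative_le (Qc z)
    rw [Qc_deg] at this
    rw [natDegree_X]
    omega) h e0
  refine lt_of_le_of_lt (degree_sub_le _ _) (max_lt ?_ d4)
  refine lt_of_le_of_lt (degree_sub_le _ _) (max_lt ?_ d3)
  exact lt_of_le_of_lt (degree_sub_le _ _) (max_lt d1 d2)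

lemma C_mul_smul (x : A) (q : ℂ[X]) (P : A[X]) : C x * (q • P) = q • (C x * P) :=
  mul_smul_comm _ _ _

lemma AtInf.mulE (hn : 1 ≤ n) {P : A[X]} {α γ : A} (h : AtInf z k P α γ) (j : Fin n) (x : A) :
    AtInf z (k+1) (Qj z j • (C x * P)) 0 (x * α) := by
  unfold AtInf at *
  set R := ((X : ℂ[X]) • P - (Qc z ^ k * X) • (C α : A[X]) - (Qc z ^ k) • (C γ : A[X])) with hR
  have key : ((X : ℂ[X]) • Qj z j • (C x * P) - (Qc z ^ (k+1) * X) • (C 0 : A[X])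
      - (Qc z ^ (k+1)) • (C (x * α) : A[X])) =
      Qj z j • (C x * R) + (Qj z j * Qc z ^ k) • C (x * γ)
       + (C (z j) * Qj z j * Qc z ^ k) • C (x * α) := by
    rw [hR]
    simp only [mul_sub, C_mul_smul, ← C_mul]
    have hq : Qc z ^ (k+1) = Qc z ^ k * ((X - C (z j)) * Qj z j) := by rw [pow_succ, ← Qc_eq]
    rw [C_0, hq]
    module
  rw [key]
  have e1 : (n - 1) + n * k + 1 = n * (k+1) := by
    have : n * (k+1) = n * k + n := by ring
    omega
  have d0 : (Qj z j * Qc z ^ k).natDegree ≤ (n - 1) + n * k := by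
    refine natDegree_mul_le.trans ?_
    rw [natDegree_pow, Qc_deg, Qj_deg, mul_comm]
  have d1 := smul_deg_lt (q := Qj z j) (c := n * (k+1)) (Qj_deg z j).le (C_mul_deg_lt x h) (by omega)
  have d2 := smul_deg_lt (c := n * (k+1)) d0 (C_deg_lt (x * γ)) e1.le
  have d3 := smul_deg_lt (q := C (z j) * Qj z j * Qc z ^ k) (c := n * (k+1)) (by
    rw [mul_assoc]; exact (natDegree_C_mul_le _ _).trans d0) (C_deg_lt (x * α)) e1.le
  refine lt_of_le_of_lt (degree_add_le _ _) (max_lt ?_ d3)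
  exact lt_of_le_of_lt (degree_add_le _ _) (max_lt d1 d2)

lemma AtInf.natDegree {P : A[X]} {α γ : A} (h : AtInf z k P α γ) : P.natDegree ≤ n * k := by
  unfold AtInf at h
  set R := ((X : ℂ[X]) • P - (Qc z ^ k * X) • (C α : A[X]) - (Qc z ^ k) • (C γ : A[X])) with hR
  have key : (X : ℂ[X]) • P = R + (Qc z ^ k * X) • (C α : A[X]) + (Qc z ^ k) • (C γ : A[X]) := by
    rw [hR]; abel
  have h1 : P.degree < ((n * k + 1 : ℕ) : WithBot ℕ) := by
    apply X_cancel_deg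
    rw [key]
    have dq : (Qc z ^ k).natDegree ≤ n * k := by rw [natDegree_pow, Qc_deg, mul_comm]
    have d1 : R.degree < ((n * k + 1 + 1 : ℕ) : WithBot ℕ) :=
      h.trans (by exact_mod_cast (by omega : n * k < n * k + 1 + 1))
    have d2 := smul_deg_lt (q := Qc z ^ k * X) (a := n * k + 1) (c := n * k + 1 + 1) (by
      refine natDegree_mul_le.trans ?_
      rw [natDegree_X]; omega) (C_deg_lt α) le_rfl
    have d3 := smul_deg_lt (q := Qc z ^ k) (c := n * k + 1 + 1) dq (C_deg_lt γ) (by omega)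
    refine lt_of_le_of_lt (degree_add_le _ _) (max_lt ?_ d3)
    exact lt_of_le_of_lt (degree_add_le _ _) (max_lt d1 d2)
  by_cases h0 : P = 0
  · simp [h0]
  have := (natDegree_lt_iff_degree_lt h0).mpr h1
  omega

variable (z : Fin n → ℂ) (K : Fin N → ℂ) (e : Fin n → Fin N → Fin N → A)

/-- Coefficient recursion for composing with `X_{ab}` on the left. -/
def stepP (a b : Fin N) (P : ℕ → A[X]) : ℕ → A[X]
  | 0 => if a = b then P 0 else 0
  | k+1 => (if a = b then P (k+1) + (Qc z • derivative (P k) - ((k : ℂ[X]) * derivative (Qc z)) • P k)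
        - (C (K a) : ℂ[X]) • (Qc z • P k) else 0) - ∑ j, Qj z j • (C (e j b a) * P k)

def Pl : List (Fin N × Fin N) → ℕ → A[X]
  | [] => fun k => if k = 0 then 1 else 0
  | p :: L => stepP z K e p.1 p.2 (Pl L)

def al : List (Fin N × Fin N) → ℕ → ℂ
  | [], k => if k = 0 then 1 else 0
  | p :: L, 0 => if p.1 = p.2 then al L 0 else 0
  | p :: L, k+1 => if p.1 = p.2 then al L (k+1) - K p.1 * al L k else 0

def ga : List (Fin N × Fin N) → ℕ → A
  | [], _ => 0
  | p :: L, 0 => if p.1 = p.2 then ga L 0 else 0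
  | p :: L, k+1 => (if p.1 = p.2 then ga L (k+1) - K p.1 • ga L k else 0)
      - ∑ j, e j p.2 p.1 * algebraMap ℂ A (al K L k)

lemma AtInf_Pl (hn : 1 ≤ n) (L : List (Fin N × Fin N)) : ∀ k,
    AtInf z k (Pl z K e L k) (algebraMap ℂ A (al K L k)) (ga K e L k) := by
  induction L with
  | nil =>
    intro k
    by_cases hk : k = 0
    · subst hk
      simp [Pl, al, ga, AtInf, X_smul]
    · simpa [Pl, al, ga, hk] using AtInf.zero
  | cons p L ih =>
    intro k
    obtain ⟨a, b⟩ := p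
    cases k with
    | zero =>
      by_cases hab : a = b
      · simpa [Pl, stepP, al, ga, hab] using ih 0
      · simpa [Pl, stepP, al, ga, hab] using AtInf.zero
    | succ k =>
      have hs : AtInf z (k+1) (∑ j, Qj z j • (C (e j b a) * Pl z K e L k)) 0
          (∑ j, e j b a * algebraMap ℂ A (al K L k)) := by
        have := AtInf.sum Finset.univ (fun j _ => (ih k).mulE hn j (e j b a))
        simpa using this
      by_cases hab : a = b
      · have h1 := (((ih (k+1)).add ((ih k).deriv hn)).sub ((ih k).mulQ.smul (K a))).sub hs
        simp only [Pl, stepP, al, ga, if_pos hab]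
        convert h1 using 1
        · simp [Algebra.smul_def]
        · simp
      · simp only [Pl, stepP, al, ga, if_neg hab]
        simpa using AtInf.zero.sub hs

lemma al_van (L : List (Fin N × Fin N)) : ∀ k, L.length < k → al K L k = 0 := by
  induction L with
  | nil => intro k hk; have : k ≠ 0 := by rintro rfl; simp at hk
           simp [al, this]
  | cons p L ih =>
    intro k hk
    simp only [List.length_cons] at hk
    cases k with
    | zero => omega
    | succ k => simp [al, ih (k+1) (by omega), ih k (by omega)]

lemma ga_van (L : List (Fin N × Fin N)) : ∀ k, L.length < k → ga K e L k = 0 := by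
  induction L with
  | nil => intro k hk; simp [ga]
  | cons p L ih =>
    intro k hk
    simp only [List.length_cons] at hk
    cases k with
    | zero => omega
    | succ k => simp [ga, ih (k+1) (by omega), ih k (by omega), al_van K L k (by omega)]

lemma Pl_van (L : List (Fin N × Fin N)) : ∀ k, L.length < k → Pl z K e L k = 0 := by
  induction L with
  | nil => intro k hk; have : k ≠ 0 := by rintro rfl; simp at hk
           simp [Pl, this]
  | cons p L ih =>
    intro k hk
    simp only [List.length_cons] at hk
    cases k with
    | zero => omega
    | succ k => simp [Pl, stepP, ih (k+1) (by omega), ih k (by omega)]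

/-- Summation bookkeeping. -/
lemma sum_shift {W : Type*} [AddCommGroup W] (l : ℕ) (g : ℕ → W) (hg : g (l+1) = 0) :
    ∑ k ∈ Finset.range (l+1), g (k+1) + g 0 = ∑ k ∈ Finset.range (l+1), g k := by
  rw [← Finset.sum_range_succ', Finset.sum_range_succ, hg, add_zero]

/-- Capelli coefficients. -/
def Cs {R : Type*} [Ring R] [Algebra ℂ R] (f : Fin N → Fin N → R) : List (Fin N × Fin N) → ℕ → R
  | [], k => if k = 0 then 1 else 0
  | p :: L, 0 => if p.1 = p.2 then Cs f L 0 else 0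
  | p :: L, k+1 => (if p.1 = p.2 then Cs f L (k+1) - (k : ℂ) • Cs f L k else 0)
      - f p.2 p.1 * Cs f L k

lemma Cs_van {R : Type*} [Ring R] [Algebra ℂ R] (f : Fin N → Fin N → R)
    (L : List (Fin N × Fin N)) : ∀ k, L.length < k → Cs f L k = 0 := by
  induction L with
  | nil => intro k hk; have : k ≠ 0 := by rintro rfl; simp at hk
           simp [Cs, this]
  | cons p L ih =>
    intro k hk
    simp only [List.length_cons] at hk
    cases k with
    | zero => omega
    | succ k => simp [Cs, ih (k+1) (by omega), ih k (by omega)]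

lemma Pl_eval (r : Fin n) {R : Type*} [Ring R] [Algebra ℂ R] (ι : R →ₐ[ℂ] A)
    (f : Fin N → Fin N → R) (hf : ∀ a b, ι (f a b) = e r a b) (L : List (Fin N × Fin N)) :
    ∀ k, ev (z r) (Pl z K e L k) = ((Qj z r).eval (z r)) ^ k • ι (Cs f L k) := by
  induction L with
  | nil =>
    intro k
    by_cases hk : k = 0 <;> simp [Pl, Cs, hk]
  | cons p L ih =>
    intro k
    obtain ⟨a, b⟩ := p
    cases k with
    | zero =>
      by_cases hab : a = b
      · simpa [Pl, stepP, Cs, hab] using ih 0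
      · simp [Pl, stepP, Cs, hab]
    | succ k =>
      have hs : ev (z r) (∑ j, Qj z j • (C (e j b a) * Pl z K e L k)) =
          ((Qj z r).eval (z r)) ^ (k+1) • ι (f b a * Cs f L k) := by
        rw [map_sum, Finset.sum_eq_single r]
        · rw [ev_smul, map_mul, ev_C, ih k, map_mul, hf, mul_smul_comm, smul_smul, pow_succ']
        · intro j _ hj
          rw [ev_smul, Qj_eval_ne z j r hj, zero_smul]
        · simp
      by_cases hab : a = b
      · simp only [Pl, stepP, Cs, if_pos hab, map_sub, map_add, hs, ev_smul, ih, map_smul,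
          Qc_eval_self, eval_mul, Qc_deriv_eval, eval_natCast]
        module
      · simp only [Pl, stepP, Cs, if_neg hab, hs, zero_sub, map_neg, smul_neg]

lemma desc_succ (d : ℂ) (k : ℕ) : (descPochhammer ℂ (k+1)).eval d =
    (d - k) * (descPochhammer ℂ k).eval d := by
  rw [descPochhammer_succ_eval, mul_comm]

/-- The generating function of the Capelli coefficients. -/
lemma Cs_gen {R : Type*} [Ring R] [Algebra ℂ R] (f : Fin N → Fin N → R) (d : ℂ)
    (p : Fin N × Fin N) (L : List (Fin N × Fin N)) :
    ∑ k ∈ Finset.range ((p :: L).length + 1),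
      (descPochhammer ℂ ((p :: L).length - k)).eval d • Cs f (p :: L) k =
    ((if p.1 = p.2 then d - L.length else 0) • (1 : R) - f p.2 p.1) *
    ∑ k ∈ Finset.range (L.length + 1), (descPochhammer ℂ (L.length - k)).eval d • Cs f L k := by
  obtain ⟨a, b⟩ := p
  simp only [List.length_cons]
  rw [Finset.sum_range_succ']
  simp only [Nat.add_sub_add_right]
  have h2 : ∀ k ∈ Finset.range (L.length + 1),
      (descPochhammer ℂ (L.length + 1 - k)).eval d • Cs f L k =
      (d - (L.length : ℂ) + k) • (descPochhammer ℂ (L.length - k)).eval d • Cs f L k := by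
    intro k hk
    have hk : k ≤ L.length := by simp at hk; omega
    rw [show L.length + 1 - k = (L.length - k) + 1 by omega, desc_succ, Nat.cast_sub hk, mul_smul]
    congr 1
    ring
  have h1 := sum_shift L.length
    (fun k => (descPochhammer ℂ (L.length + 1 - k)).eval d • Cs f L k)
    (by rw [Cs_van f L _ (by omega), smul_zero])
  simp only [Nat.add_sub_add_right] at h1
  rw [sub_mul, smul_mul_assoc, one_mul, Finset.mul_sum]
  by_cases hab : a = b
  · simp only [Cs, if_pos hab, smul_sub, Finset.sum_sub_distrib]
    rw [Finset.sum_congr rfl h2] at h1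
    have h3 : ∀ (x y w v : R), x - y - w + v = (x + v) - y - w := by intros; abel
    rw [h3, h1, Finset.smul_sum, ← Finset.sum_sub_distrib]
    congr 1
    · apply Finset.sum_congr rfl
      intro k _
      module
    · simp [mul_smul_comm]
  · simp [Cs, if_neg hab, mul_smul_comm]

lemma Cs_gen' {R : Type*} [Ring R] [Algebra ℂ R] (f : Fin N → Fin N → R) (d : ℂ) :
    ∀ (l : ℕ) (p : Fin l → Fin N × Fin N),
    ∑ k ∈ Finset.range (l + 1),
      (descPochhammer ℂ (l - k)).eval d • Cs f (List.ofFn p) k =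
    (List.ofFn fun i : Fin l => (if (p i).1 = (p i).2 then d - (l - 1 - (i : ℕ) : ℂ) else 0) • (1 : R)
      - f (p i).2 (p i).1).prod := by
  intro l
  induction l with
  | zero => intro p; simp [Cs]
  | succ l ih =>
    intro p
    have h1 := Cs_gen f d (p 0) (List.ofFn fun i : Fin l => p i.succ)
    have h2 := ih (fun i => p i.succ)
    simp only [List.length_cons, List.length_ofFn] at h1
    have h3 : ∀ i : ℕ, ((l + 1 : ℕ) : ℂ) - 1 - ((i + 1 : ℕ) : ℂ) = l - 1 - i := by
      intro i; push_cast; ring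
    rw [List.ofFn_succ, h1, h2, List.ofFn_succ, List.prod_cons]
    simp only [Fin.val_succ, h3]
    simp

lemma al_gen (x : ℂ) (p : Fin N × Fin N) (L : List (Fin N × Fin N)) :
    ∑ k ∈ Finset.range ((p :: L).length + 1), x ^ ((p :: L).length - k) * al K (p :: L) k =
    (if p.1 = p.2 then x - K p.1 else 0) *
    ∑ k ∈ Finset.range (L.length + 1), x ^ (L.length - k) * al K L k := by
  obtain ⟨a, b⟩ := p
  simp only [List.length_cons]
  rw [Finset.sum_range_succ']
  simp only [Nat.add_sub_add_right]
  have h2 : ∀ k ∈ Finset.range (L.length + 1),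
      x ^ (L.length + 1 - k) * al K L k = x * (x ^ (L.length - k) * al K L k) := by
    intro k hk
    have hk : k ≤ L.length := by simp at hk; omega
    rw [show L.length + 1 - k = (L.length - k) + 1 by omega]
    ring
  have h1 := sum_shift L.length (fun k => x ^ (L.length + 1 - k) * al K L k)
    (by rw [al_van K L _ (by omega), mul_zero])
  simp only [Nat.add_sub_add_right] at h1
  by_cases hab : a = b
  · simp only [al, if_pos hab, mul_sub, Finset.sum_sub_distrib]
    rw [Finset.sum_congr rfl h2, ← Finset.mul_sum] at h1
    have h3 : ∀ (x y v : ℂ), x - y + v = (x + v) - y := by intros; ring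
    rw [h3, h1, sub_mul]
    congr 1
    rw [Finset.mul_sum]
    apply Finset.sum_congr rfl
    intro k _
    ring
  · simp [al, if_neg hab]

lemma ga_gen (x : ℂ) (p : Fin N × Fin N) (L : List (Fin N × Fin N)) :
    ∑ k ∈ Finset.range ((p :: L).length + 1), x ^ ((p :: L).length - k) • ga K e (p :: L) k =
    (if p.1 = p.2 then x - K p.1 else 0) •
    ∑ k ∈ Finset.range (L.length + 1), x ^ (L.length - k) • ga K e L k
    - (∑ k ∈ Finset.range (L.length + 1), x ^ (L.length - k) * al K L k) • ∑ j, e j p.2 p.1 := by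
  obtain ⟨a, b⟩ := p
  simp only [List.length_cons]
  rw [Finset.sum_range_succ']
  simp only [Nat.add_sub_add_right]
  have h2 : ∀ k ∈ Finset.range (L.length + 1),
      x ^ (L.length + 1 - k) • ga K e L k = x • (x ^ (L.length - k) • ga K e L k) := by
    intro k hk
    have hk : k ≤ L.length := by simp at hk; omega
    rw [show L.length + 1 - k = (L.length - k) + 1 by omega, smul_smul]
    congr 1
    ring
  have h1 := sum_shift L.length (fun k => x ^ (L.length + 1 - k) • ga K e L k)
    (by rw [ga_van K e L _ (by omega), smul_zero])
  simp only [Nat.add_sub_add_right] at h1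
  have h4 : ∀ k, ∑ j, e j b a * algebraMap ℂ A (al K L k) = al K L k • ∑ j, e j b a := by
    intro k
    rw [Finset.smul_sum]
    apply Finset.sum_congr rfl
    intro j _
    rw [← Algebra.commutes, Algebra.smul_def]
  by_cases hab : a = b
  · simp only [ga, if_pos hab, smul_sub, Finset.sum_sub_distrib, h4]
    rw [Finset.sum_congr rfl h2, ← Finset.smul_sum] at h1
    have h3 : ∀ (x y w v : A), x - y - w + v = (x + v) - y - w := by intros; abel
    rw [h3, h1, sub_smul]
    congr 1
    · congr 1
      rw [Finset.smul_sum]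
      apply Finset.sum_congr rfl
      intro k _
      module
    · rw [Finset.sum_smul]
      apply Finset.sum_congr rfl
      intro k _
      rw [smul_smul]
  · simp only [ga, if_neg hab, h4, zero_sub, zero_smul, smul_zero, add_zero, smul_neg,
      Finset.sum_neg_distrib, Finset.sum_smul, smul_smul]

lemma al_gen' (x : ℂ) : ∀ (l : ℕ) (p : Fin l → Fin N × Fin N),
    ∑ k ∈ Finset.range (l + 1), x ^ (l - k) * al K (List.ofFn p) k =
      ∏ i, (if (p i).1 = (p i).2 then x - K (p i).1 else 0) := by
  intro l
  induction l with
  | zero => intro p; simp [al]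
  | succ l ih =>
    intro p
    have h1 := al_gen K x (p 0) (List.ofFn fun i : Fin l => p i.succ)
    have h2 := ih (fun i => p i.succ)
    simp only [List.length_cons, List.length_ofFn] at h1
    rw [List.ofFn_succ, h1, h2, Fin.prod_univ_succ]

lemma ga_gen' (x : ℂ) : ∀ (l : ℕ) (p : Fin l → Fin N × Fin N),
    ∑ k ∈ Finset.range (l + 1), x ^ (l - k) • ga K e (List.ofFn p) k =
      - ∑ i, (∏ i', (if i' = i then 1 else if (p i').1 = (p i').2 then x - K (p i').1 else 0)) •
        ∑ j, e j (p i).2 (p i).1 := by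
  intro l
  induction l with
  | zero => intro p; simp [ga]
  | succ l ih =>
    intro p
    have h1 := ga_gen K e x (p 0) (List.ofFn fun i : Fin l => p i.succ)
    have h2 := ih (fun i => p i.succ)
    have h3 := al_gen' K x l (fun i => p i.succ)
    simp only [List.length_cons, List.length_ofFn] at h1
    rw [List.ofFn_succ, h1, h2, h3, Fin.sum_univ_succ]
    simp only [Fin.prod_univ_succ, if_true, one_mul, (Fin.succ_ne_zero _), if_false,
      (Fin.succ_ne_zero _).symm, Fin.succ_inj, mul_smul, ← Finset.smul_sum]
    rw [smul_neg, neg_add]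
    abel

lemma Cs_zero {R : Type*} [Ring R] [Algebra ℂ R] (f : Fin N → Fin N → R)
    (L : List (Fin N × Fin N)) : Cs f L 0 = if ∀ p ∈ L, p.1 = p.2 then 1 else 0 := by
  induction L with
  | nil => simp [Cs]
  | cons p L ih =>
    by_cases h : p.1 = p.2 <;> simp [Cs, h, ih]

lemma uniq_scalar (p : ℕ → ℂ[X]) (hp : ∀ k, (p k).Monic) (hd : ∀ k, (p k).natDegree = k) :
    ∀ (N : ℕ) (v : ℕ → ℂ), (∑ k ∈ Finset.range (N+1), C (v k) * p (N - k) = 0) →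
      ∀ k ≤ N, v k = 0 := by
  intro N
  induction N with
  | zero =>
    intro v h k hk
    obtain rfl : k = 0 := by omega
    have : p 0 = 1 := (hp 0).natDegree_eq_zero.mp (hd 0)
    simpa [this] using h
  | succ N ih =>
    intro v h
    rw [Finset.sum_range_succ'] at h
    simp only [Nat.add_sub_add_right, Nat.sub_zero] at h
    have h0 : v 0 = 0 := by
      have := congrArg (fun q => coeff q (N+1)) h
      simp only [coeff_add, finsetSum_coeff, coeff_C_mul, coeff_zero] at this
      rw [Finset.sum_eq_zero, zero_add] at this
      · have h1 : (p (N+1)).coeff (N+1) = 1 := by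
          have := (hp (N+1)).coeff_natDegree
          rwa [hd] at this
        rwa [h1, mul_one] at this
      · intro k _
        rw [coeff_eq_zero_of_natDegree_lt (by rw [hd]; omega), mul_zero]
    rw [h0, C_0, zero_mul, add_zero] at h
    intro k hk
    cases k with
    | zero => exact h0
    | succ k => exact ih (fun k => v (k+1)) h k (by omega)

lemma uniq_vec {W : Type*} [AddCommGroup W] [Module ℂ W]
    (p : ℕ → ℂ[X]) (hp : ∀ k, (p k).Monic) (hd : ∀ k, (p k).natDegree = k)
    (N : ℕ) (v v' : ℕ → W) (h : ∀ x : ℂ, ∑ k ∈ Finset.range (N+1), (p (N - k)).eval x • v k =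
      ∑ k ∈ Finset.range (N+1), (p (N - k)).eval x • v' k) :
      ∀ k ≤ N, v k = v' k := by
  intro k hk
  rw [← sub_eq_zero]
  rw [← Module.forall_dual_apply_eq_zero_iff ℂ]
  intro f
  refine uniq_scalar p hp hd N (fun k => f (v k - v' k)) ?_ k hk
  apply Polynomial.funext
  intro x
  have := congrArg f (sub_eq_zero.mpr (h x))
  rw [← Finset.sum_sub_distrib, map_sum, map_zero] at this
  rw [eval_finsetSum, eval_zero, ← this]
  apply Finset.sum_congr rfl
  intro i _
  rw [← smul_sub, map_smul, eval_mul, eval_C, smul_eq_mul, mul_comm]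

end Alg

section Ana
open Polynomial Filter Topology
attribute [local instance] Polynomial.algebra

lemma Qc_ne {n : ℕ} {z : Fin n → ℂ} {u : ℂ} (hu : GoodG z u) : (Qc z).eval u ≠ 0 := by
  rw [Qc_eval]
  exact Finset.prod_ne_zero_iff.mpr fun j _ => sub_ne_zero.mpr (hu j)

lemma good_ev {n : ℕ} {z : Fin n → ℂ} {u : ℂ} (hu : GoodG z u) : ∀ᶠ t in 𝓝 u, GoodG z t := by
  unfold GoodG
  rw [eventually_all]
  exact fun j => isOpen_ne.mem_nhds (hu j)

lemma good_cob {n : ℕ} (z : Fin n → ℂ) : ∀ᶠ t in Bornology.cobounded ℂ, GoodG z t := by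
  unfold GoodG
  rw [eventually_all]
  intro j
  exact Bornology.eventually_ne_cobounded (z j)

variable {M : Type*} [NormedAddCommGroup M] [NormedSpace ℂ M] [FiniteDimensional ℂ M]

lemma ev_monomial (t : ℂ) (i : ℕ) (a : Module.End ℂ M) : ev t (monomial i a) = t ^ i • a := by
  rw [ev_apply, eval_monomial, _root_.smul_pow, one_pow, mul_smul_comm, mul_one]

lemma ev_hasDerivAt (P : (Module.End ℂ M)[X]) {w : ℂ → M} {w' : M} {u : ℂ}
    (hw : HasDerivAt w w' u) :
    HasDerivAt (fun t => ev t P (w t)) (ev u (derivative P) (w u) + ev u P w') u := by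
  induction P using Polynomial.induction_on' with
  | add p q hp hq =>
    simp only [map_add, LinearMap.add_apply]
    refine (hp.fun_add hq).congr_deriv ?_
    abel
  | monomial i a =>
    simp only [ev_monomial, derivative_monomial, LinearMap.smul_apply]
    have h1 : HasDerivAt (fun t => a (w t)) (a w') u :=
      (LinearMap.toContinuousLinearMap a).hasFDerivAt.comp_hasDerivAt u hw
    refine ((hasDerivAt_pow i u).fun_smul h1).congr_deriv ?_
    rw [add_comm]
    congr 1
    rw [Module.End.mul_apply]
    have : ((i : Module.End ℂ M)) (w u) = (i : ℂ) • w u := by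
      rw [← nsmul_one, LinearMap.smul_apply, Module.End.one_apply, Nat.cast_smul_eq_nsmul]
    rw [this, map_smul, smul_smul, mul_comm]

lemma Qinv_hasDerivAt {n : ℕ} {z : Fin n → ℂ} {u : ℂ} (hu : GoodG z u) (k : ℕ) :
    HasDerivAt (fun t => ((Qc z).eval t ^ k)⁻¹)
      (-(((Qc z).eval u ^ (k+1))⁻¹ * (k * (derivative (Qc z)).eval u))) u := by
  have h0 := Qc_ne hu
  refine ((((Qc z).hasDerivAt u).fun_pow k).fun_inv (pow_ne_zero k h0)).congr_deriv ?_
  cases k with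
  | zero => simp
  | succ k =>
    simp only [Nat.add_sub_cancel]
    field_simp
    ring

lemma iter_hasDerivAt {f : ℂ → M} (hf : Differentiable ℂ f) (m : ℕ) (u : ℂ) :
    HasDerivAt (iteratedDeriv m f) (iteratedDeriv (m+1) f u) u := by
  have := FiniteDimensional.complete ℂ M
  have h1 : ContDiff ℂ (⊤ : ℕ∞) f := hf.contDiff
  have h2 := h1.differentiable_iteratedDeriv m (by exact_mod_cast ENat.natCast_lt_top m)
  rw [iteratedDeriv_succ]
  exact (h2 u).hasDerivAt

variable {n N : ℕ} (V : Fin n → Type*) [∀ i, AddCommGroup (V i)] [∀ i, Module ℂ (V i)]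
  (E : ∀ i : Fin n, Fin N → Fin N → (V i →ₗ[ℂ] V i))
  (φ : M ≃ₗ[ℂ] PiTensorProduct ℂ V) (z : Fin n → ℂ) (K : Fin N → ℂ)

lemma op_formula (f : ℂ → M) (hf : Differentiable ℂ f) (L : List (Fin N × Fin N)) :
    ∀ u, GoodG z u →
    ((L.map fun p => Xg V M E φ z (Matrix.diagonal K) p.1 p.2).foldr (· ∘ ·) id) f u =
    ∑ k ∈ Finset.range (L.length + 1), ((Qc z).eval u ^ k)⁻¹ •
      ev u (Pl z K (EE V M E φ) L k) (iteratedDeriv (L.length - k) f u) := by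
  induction L with
  | nil => intro u hu; simp [Pl]
  | cons p L ih =>
    intro u hu
    obtain ⟨a, b⟩ := p
    have h0 := Qc_ne hu
    set g := ((L.map fun p => Xg V M E φ z (Matrix.diagonal K) p.1 p.2).foldr (· ∘ ·) id) f with hg
    have hL : (((((a, b) :: L).map fun p => Xg V M E φ z (Matrix.diagonal K) p.1 p.2).foldr
      (· ∘ ·) id) f u) = Xg V M E φ z (Matrix.diagonal K) a b g u := rfl
    rw [hL]
    set q := (Qc z).eval u with hq
    set e := EE V M E φ with he
    set P := Pl z K e L with hP
    set F := fun m => iteratedDeriv m f u with hF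
    have hder : deriv g u = ∑ k ∈ Finset.range (L.length + 1),
        ((q ^ k)⁻¹ • (ev u (derivative (P k)) (F (L.length - k)) + ev u (P k) (F (L.length - k + 1)))
          + (-((q ^ (k+1))⁻¹ * (k * (derivative (Qc z)).eval u))) • ev u (P k) (F (L.length - k))) := by
      have h1 : g =ᶠ[𝓝 u] fun t => ∑ k ∈ Finset.range (L.length + 1), ((Qc z).eval t ^ k)⁻¹ •
          ev t (P k) (iteratedDeriv (L.length - k) f t) := by
        filter_upwards [good_ev hu] with t ht
        exact ih t ht
      rw [h1.deriv_eq]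
      apply HasDerivAt.deriv
      apply HasDerivAt.fun_sum
      intro k _
      exact (Qinv_hasDerivAt hu k).smul (ev_hasDerivAt (P k) (iter_hasDerivAt hf _ u))
    have hgu : g u = ∑ k ∈ Finset.range (L.length + 1),
        (q ^ k)⁻¹ • ev u (P k) (F (L.length - k)) := ih u hu
    simp only [List.length_cons]
    rw [Finset.sum_range_succ']
    simp only [Nat.add_sub_add_right]
    have hsh := sum_shift L.length (fun k => (q ^ k)⁻¹ • ev u (P k) (F (L.length + 1 - k)))
      (by simp [hP, Pl_van z K e L (L.length + 1) (by omega)])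
    simp only [Nat.add_sub_add_right] at hsh
    have hqj : ∀ (j : Fin n) (k : ℕ), (q ^ (k+1))⁻¹ * (Qj z j).eval u = (u - z j)⁻¹ * (q ^ k)⁻¹ := by
      intro j k
      have h1 : q = (u - z j) * (Qj z j).eval u := by rw [hq, Qc_eq z j]; simp
      have h2 : u - z j ≠ 0 := sub_ne_zero.mpr (hu j)
      have h3 : (Qj z j).eval u ≠ 0 := by
        intro h; rw [h, mul_zero] at h1; exact h0 h1
      rw [h1]
      field_simp
      ring
    have hE : ∑ j : Fin n, (u - z j)⁻¹ • (e j b a) (g u) =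
        ∑ k ∈ Finset.range (L.length + 1), (q ^ (k+1))⁻¹ •
          ev u (∑ j, Qj z j • (C (e j b a) * P k)) (F (L.length - k)) := by
      simp only [hgu, map_sum, Finset.smul_sum, LinearMap.sum_apply]
      rw [Finset.sum_comm]
      apply Finset.sum_congr rfl
      intro k _
      apply Finset.sum_congr rfl
      intro j _
      rw [ev_smul, map_mul, ev_C, LinearMap.smul_apply, smul_smul, hqj, Module.End.mul_apply,
        map_smul, smul_smul]
    unfold Xg
    rw [← he, hE]
    by_cases hab : a = b
    · subst hab
      simp only [if_true, Matrix.diagonal_apply_eq, Pl, stepP, ← hP, map_sub, map_add,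
        LinearMap.sub_apply, LinearMap.add_apply, smul_sub, smul_add, Finset.sum_sub_distrib,
        Finset.sum_add_distrib]
      have h3 : ∀ (x y w v s t : M), x + (y - w) - v - s + t = (x + t) + (y - w) - v - s := by
        intros; abel
      simp only [hF] at hsh hder hgu ⊢
      rw [h3, hsh, hder, hgu, Finset.smul_sum, ← Finset.sum_sub_distrib, ← Finset.sum_sub_distrib,
        ← Finset.sum_sub_distrib, ← Finset.sum_add_distrib, ← Finset.sum_sub_distrib,
        ← Finset.sum_sub_distrib]
      apply Finset.sum_congr rfl
      intro k hk
      have hk' : L.length + 1 - k = L.length - k + 1 := by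
        have := Finset.mem_range.mp hk
        omega
      have hqq : (q ^ (k+1))⁻¹ * q = (q ^ k)⁻¹ := by
        field_simp
        ring
      rw [hk', ev_smul, ev_smul, ev_smul, ev_smul, eval_mul, eval_natCast, eval_C, ← hq]
      simp only [LinearMap.smul_apply, smul_smul, neg_smul, smul_add]
      rw [hqq, mul_left_comm ((q ^ (k+1))⁻¹) (K a), hqq]
      abel
    · simp only [if_neg hab, Matrix.diagonal_apply_ne _ hab, Pl, stepP, ← hP, map_sub, map_zero,
        LinearMap.sub_apply, LinearMap.zero_apply, zero_sub, zero_smul, sub_zero, smul_zero, add_zero,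
        hF]
      simp only [map_neg, LinearMap.neg_apply, smul_neg, Finset.sum_neg_distrib]

lemma quot_tendsto (z : Fin n → ℂ) (k i : ℕ) (hi : i < n * k) :
    Tendsto (fun u : ℂ => ((Qc z).eval u ^ k)⁻¹ * u ^ i) (Bornology.cobounded ℂ) (𝓝 0) := by
  have hinv : Tendsto (fun u : ℂ => u⁻¹) (Bornology.cobounded ℂ) (𝓝 0) := tendsto_inv₀_cobounded
  have h1 : Tendsto (fun u : ℂ => ∏ s, (1 - z s * u⁻¹)) (Bornology.cobounded ℂ) (𝓝 1) := by
    have : Tendsto (fun u : ℂ => ∏ s, (1 - z s * u⁻¹)) (Bornology.cobounded ℂ)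
        (𝓝 (∏ s, (1 - z s * 0))) :=
      tendsto_finsetProd _ fun s _ => tendsto_const_nhds.sub (hinv.const_mul _)
    simpa using this
  have h2 : Tendsto (fun u : ℂ => ((∏ s, (1 - z s * u⁻¹)) ^ k)⁻¹ * (u⁻¹) ^ (n * k - i))
      (Bornology.cobounded ℂ) (𝓝 (((1:ℂ) ^ k)⁻¹ * 0 ^ (n * k - i))) :=
    ((h1.pow k).inv₀ (by simp)).mul (hinv.pow _)
  rw [zero_pow (by omega), mul_zero] at h2
  refine h2.congr' ?_
  filter_upwards [Bornology.eventually_ne_cobounded (0:ℂ)] with u hu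
  have h3 : (Qc z).eval u = u ^ n * ∏ s, (1 - z s * u⁻¹) := by
    rw [Qc_eval]
    have : ∀ s, u - z s = u * (1 - z s * u⁻¹) := by intro s; field_simp
    simp only [this, Finset.prod_mul_distrib]
    simp
  rw [h3, mul_pow, mul_inv, ← pow_mul]
  have h4 : u ^ (n * k) = u ^ i * u ^ (n * k - i) := by rw [← pow_add]; congr 1; omega
  rw [h4, mul_inv, inv_pow u]
  have : u ^ i ≠ 0 := pow_ne_zero _ hu
  field_simp

lemma lim_zero (z : Fin n → ℂ) (k : ℕ) (R : (Module.End ℂ M)[X])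
    (hR : R.degree < ((n * k : ℕ) : WithBot ℕ)) (w : M) :
    Tendsto (fun u : ℂ => ((Qc z).eval u ^ k)⁻¹ • ev u R w) (Bornology.cobounded ℂ) (𝓝 0) := by
  have h1 : ∀ u : ℂ, ((Qc z).eval u ^ k)⁻¹ • ev u R w =
      ∑ i ∈ Finset.range (n * k), (((Qc z).eval u ^ k)⁻¹ * u ^ i) • R.coeff i w := by
    intro u
    by_cases h0 : R = 0
    · simp [h0]
    have h2 : R.natDegree < n * k := (natDegree_lt_iff_degree_lt h0).mpr hR
    rw [ev_apply, eval_eq_sum_range' h2, LinearMap.sum_apply, Finset.smul_sum]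
    apply Finset.sum_congr rfl
    intro i _
    rw [_root_.smul_pow, one_pow, mul_smul_comm, mul_one, LinearMap.smul_apply, smul_smul]
  simp only [h1]
  have : Tendsto (fun u : ℂ => ∑ i ∈ Finset.range (n * k),
      (((Qc z).eval u ^ k)⁻¹ * u ^ i) • R.coeff i w) (Bornology.cobounded ℂ)
      (𝓝 (∑ i ∈ Finset.range (n * k), (0:ℂ) • R.coeff i w)) :=
    tendsto_finsetSum _ fun i hi => (quot_tendsto z k i (by simpa using hi)).smul_const _
  simpa using this

lemma AtInf.lim {z : Fin n → ℂ} {k : ℕ} {P : (Module.End ℂ M)[X]} {α γ : Module.End ℂ M}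
    (h : AtInf z k P α γ) (F : ℂ → M) (w : M)
    (hF : ∀ u, GoodG z u → F u = ((Qc z).eval u ^ k)⁻¹ • ev u P w) :
    Tendsto F (Bornology.cobounded ℂ) (𝓝 (α w)) ∧
    Tendsto (fun u => u • (F u - α w)) (Bornology.cobounded ℂ) (𝓝 (γ w)) := by
  have h1 := lim_zero z k _ h w
  have h2 : Tendsto (fun u => u • (F u - α w)) (Bornology.cobounded ℂ) (𝓝 (γ w)) := by
    have h3 := h1.add_const (γ w)
    rw [zero_add] at h3
    refine h3.congr' ?_
    filter_upwards [good_cob z] with u hu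
    have h0 : ((Qc z).eval u) ^ k ≠ 0 := pow_ne_zero _ (Qc_ne hu)
    rw [hF u hu, map_sub, map_sub, ev_smul, ev_smul, ev_smul, ev_C, ev_C, eval_X, eval_mul, eval_pow,
      eval_X]
    simp only [LinearMap.sub_apply, LinearMap.smul_apply, smul_sub, smul_smul]
    rw [inv_mul_cancel₀ h0, ← mul_assoc, inv_mul_cancel₀ h0, one_mul, one_smul, mul_comm u]
    abel
  refine ⟨?_, h2⟩
  have hinv : Tendsto (fun u : ℂ => u⁻¹) (Bornology.cobounded ℂ) (𝓝 0) := tendsto_inv₀_cobounded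
  have h4 := (hinv.smul h2).add_const (α w)
  rw [zero_smul, zero_add] at h4
  refine h4.congr' ?_
  filter_upwards [Bornology.eventually_ne_cobounded (0:ℂ)] with u hu
  rw [smul_smul, inv_mul_cancel₀ hu, one_smul, sub_add_cancel]

end Ana

section Fin1
open Polynomial Filter Topology
attribute [local instance] Polynomial.algebra

/-- sign of a permutation as a complex number -/
def sg {N : ℕ} (σ : Equiv.Perm (Fin N)) : ℂ := (((Equiv.Perm.sign σ : ℤˣ) : ℤ) : ℂ)

lemma sg_one {N : ℕ} : sg (1 : Equiv.Perm (Fin N)) = 1 := by simp [sg]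

def LL {N : ℕ} (σ : Equiv.Perm (Fin N)) : List (Fin N × Fin N) := List.ofFn fun a => (a, σ a)

lemma perm_eq_one {N : ℕ} {σ : Equiv.Perm (Fin N)} (i : Fin N) (h : ∀ j, j ≠ i → σ j = j) :
    σ = 1 := by
  ext j
  by_cases hj : j = i
  · subst hj
    by_contra hne
    have hne' : σ j ≠ j := fun h' => hne (by rw [h']; rfl)
    have := h (σ j) hne'
    exact hne' (σ.injective this)
  · rw [h j hj]; rfl

section
variable {A : Type*} [Ring A] [Algebra ℂ A] {n N : ℕ}
  (z : Fin n → ℂ) (K : Fin N → ℂ) (e : Fin n → Fin N → Fin N → A)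

def PT (k : ℕ) : A[X] := ∑ σ : Equiv.Perm (Fin N), (C (sg σ) : ℂ[X]) • Pl z K e (LL σ) k
def alT (k : ℕ) : ℂ := ∑ σ : Equiv.Perm (Fin N), sg σ * al K (LL σ) k
def gaT (k : ℕ) : A := ∑ σ : Equiv.Perm (Fin N), sg σ • ga K e (LL σ) k
def CT {R : Type*} [Ring R] [Algebra ℂ R] (f : Fin N → Fin N → R) (k : ℕ) : R :=
  ∑ σ : Equiv.Perm (Fin N), sg σ • Cs f (LL σ) k

lemma AtInf_PT (hn : 1 ≤ n) (k : ℕ) :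
    AtInf z k (PT z K e k) (algebraMap ℂ A (alT K k)) (gaT K e k) := by
  have := AtInf.sum Finset.univ (fun σ (_ : σ ∈ (Finset.univ : Finset (Equiv.Perm (Fin N)))) =>
    (AtInf_Pl z K e hn (LL σ) k).smul (sg σ))
  have hα : algebraMap ℂ A (alT K k) =
      ∑ σ : Equiv.Perm (Fin N), sg σ • algebraMap ℂ A (al K (LL σ) k) := by
    rw [alT, map_sum]
    apply Finset.sum_congr rfl
    intro σ _
    rw [map_mul, Algebra.smul_def]
  rw [hα]
  exact this

lemma alT_gen (x : ℂ) : ∑ k ∈ Finset.range (N + 1), x ^ (N - k) * alT K k = ∏ i, (x - K i) := by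
  simp only [alT, Finset.mul_sum]
  rw [Finset.sum_comm]
  have h : ∀ σ : Equiv.Perm (Fin N), ∑ k ∈ Finset.range (N + 1),
      x ^ (N - k) * (sg σ * al K (LL σ) k) = sg σ * ∏ i, (if i = σ i then x - K i else 0) := by
    intro σ
    rw [← al_gen' K x N (fun a => (a, σ a)), Finset.mul_sum]
    apply Finset.sum_congr rfl
    intro k _
    rw [LL]; ring
  simp only [h]
  rw [Finset.sum_eq_single 1]
  · simp [sg_one]
  · intro σ _ hσ
    by_cases hi : ∃ i, i ≠ σ i
    · obtain ⟨i, hi⟩ := hi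
      rw [Finset.prod_eq_zero (Finset.mem_univ i) (if_neg hi), mul_zero]
    · push Not at hi
      exact absurd (Equiv.ext fun i => (hi i).symm) hσ
  · simp

lemma gaT_gen (x : ℂ) : ∑ k ∈ Finset.range (N + 1), x ^ (N - k) • gaT K e k =
    - ∑ i, (∏ i' ∈ Finset.univ.erase i, (x - K i')) • ∑ j, e j i i := by
  simp only [gaT, Finset.smul_sum]
  rw [Finset.sum_comm]
  have h : ∀ σ : Equiv.Perm (Fin N), ∑ k ∈ Finset.range (N + 1),
      x ^ (N - k) • (sg σ • ga K e (LL σ) k) = sg σ • (- ∑ i,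
        (∏ i', (if i' = i then 1 else if i' = σ i' then x - K i' else 0)) •
        ∑ j, e j (σ i) i) := by
    intro σ
    rw [← ga_gen' K e x N (fun a => (a, σ a)), Finset.smul_sum]
    apply Finset.sum_congr rfl
    intro k _
    rw [LL, smul_comm]
  simp only [h]
  rw [Finset.sum_eq_single 1]
  · rw [sg_one, one_smul]
    congr 1
    apply Finset.sum_congr rfl
    intro i _
    rw [Finset.smul_sum]
    congr 1
    · ext j
      congr 1
      rw [← Finset.mul_prod_erase _ _ (Finset.mem_univ i)]
      simp only [if_true, one_mul, Equiv.Perm.one_apply]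
      apply Finset.prod_congr rfl
      intro i' hi'
      rw [if_neg (Finset.ne_of_mem_erase hi')]
  · intro σ _ hσ
    rw [Finset.sum_eq_zero, neg_zero, smul_zero]
    intro i _
    have : ∃ i', i' ≠ i ∧ i' ≠ σ i' := by
      by_contra hc
      push Not at hc
      exact hσ (perm_eq_one i fun j hj => (hc j hj).symm)
    obtain ⟨i', h1, h2⟩ := this
    rw [Finset.prod_eq_zero (Finset.mem_univ i') (by rw [if_neg h1, if_neg h2]), zero_smul]
  · simp

lemma CT_gen {R : Type*} [Ring R] [Algebra ℂ R] (f : Fin N → Fin N → R) (d : ℂ) :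
    ∑ k ∈ Finset.range (N + 1), (descPochhammer ℂ (N - k)).eval d • CT f k =
      FC f (fun i => d - (N - 1 - (i : ℕ) : ℂ)) id id := by
  simp only [CT, Finset.smul_sum]
  rw [Finset.sum_comm]
  unfold FC FF
  apply Finset.sum_congr rfl
  intro σ _
  have := Cs_gen' f d N (fun a => (a, σ a))
  have h2 : (((Equiv.Perm.sign σ : ℤˣ) : ℤ)) • (List.ofFn fun i : Fin N =>
      XX f (d - (N - 1 - (i : ℕ) : ℂ)) i (σ i)).prod =
      sg σ • (List.ofFn fun i : Fin N =>
      XX f (d - (N - 1 - (i : ℕ) : ℂ)) i (σ i)).prod := by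
    rw [sg, Int.cast_smul_eq_zsmul]
  refine Eq.trans ?_ h2.symm
  unfold XX
  rw [← this, Finset.smul_sum]
  apply Finset.sum_congr rfl
  intro k _
  rw [LL, smul_comm]

lemma CT_zero {R : Type*} [Ring R] [Algebra ℂ R] (f : Fin N → Fin N → R) : CT f 0 = 1 := by
  unfold CT
  rw [Finset.sum_eq_single 1]
  · rw [sg_one, one_smul, Cs_zero, if_pos]
    intro p hp
    rw [LL, List.mem_ofFn] at hp
    obtain ⟨i, rfl⟩ := hp
    rfl
  · intro σ _ hσ
    rw [Cs_zero, if_neg, smul_zero]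
    intro h
    apply hσ
    ext i
    have := h (i, σ i) (by rw [LL, List.mem_ofFn]; exact ⟨i, rfl⟩)
    simp only at this
    rw [← this]; rfl
  · simp

lemma PT_eval (r : Fin n) {R : Type*} [Ring R] [Algebra ℂ R] (ι : R →ₐ[ℂ] A)
    (f : Fin N → Fin N → R) (hf : ∀ a b, ι (f a b) = e r a b) (k : ℕ) :
    ev (z r) (PT z K e k) = ((Qj z r).eval (z r)) ^ k • ι (CT f k) := by
  unfold PT CT
  rw [map_sum, map_sum, Finset.smul_sum]
  apply Finset.sum_congr rfl
  intro σ _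
  rw [ev_smul, eval_C, Pl_eval z K e r ι f hf, map_smul, smul_comm]

end

lemma CT_scalar {N : ℕ} {V : Type*} [AddCommGroup V] [Module ℂ V]
    (f : Fin N → Fin N → Module.End ℂ V) (hf : GR f) (lam : Fin N → ℂ) (v : V) (hv : v ≠ 0)
    (h1 : ∀ a b : Fin N, a < b → f a b v = 0) (h2 : ∀ a, f a a v = lam a • v)
    (h3 : ∀ W : Submodule ℂ V, (∀ a b : Fin N, ∀ x ∈ W, f a b x ∈ W) → v ∈ W → ∀ x, x ∈ W) :
    ∃ c : ℕ → ℂ, c 0 = 1 ∧ (∀ k ≤ N, CT f k = c k • 1) ∧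
      ∀ d : ℂ, ∑ k ∈ Finset.range (N + 1), (descPochhammer ℂ (N - k)).eval d * c k =
        ∏ i : Fin N, (d - (N - 1 - (i : ℕ) : ℂ) - lam i) := by
  have hFC : ∀ d : ℂ, FC f (fun i => d - (N - 1 - (i : ℕ) : ℂ)) id id =
      (∏ i : Fin N, (d - (N - 1 - (i : ℕ) : ℂ) - lam i)) • (1 : Module.End ℂ V) := by
    intro d
    set s : Fin N → ℂ := fun i => d - (N - 1 - (i : ℕ) : ℂ) with hs
    set G := FC f s id id with hG
    have hc := capelli_central hf s (by
      intro i j hij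
      simp only [hs, hij]
      push_cast; ring)
    ext x
    have := h3 (LinearMap.ker (G - (∏ i : Fin N, (s i - lam i)) • (1 : Module.End ℂ V))) (by
      intro a b x hx
      rw [LinearMap.mem_ker, LinearMap.sub_apply, sub_eq_zero] at hx ⊢
      have h4 : G (f a b x) = f a b (G x) := (LinearMap.congr_fun (hc a b) x).symm
      rw [h4, hx]
      simp) (by
      rw [LinearMap.mem_ker, LinearMap.sub_apply, sub_eq_zero, hG, capelli_hw f s lam v h1 h2]
      simp) x
    rw [LinearMap.mem_ker, LinearMap.sub_apply, sub_eq_zero] at this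
    exact this
  obtain ⟨g, hg⟩ := Module.Projective.exists_dual_ne_zero ℂ hv
  have hsum : ∀ d : ℂ, ∑ k ∈ Finset.range (N + 1), (descPochhammer ℂ (N - k)).eval d *
      (g (CT f k v) / g v) = ∏ i : Fin N, (d - (N - 1 - (i : ℕ) : ℂ) - lam i) := by
    intro d
    have h5 := congrArg (fun T : Module.End ℂ V => g (T v) / g v) ((CT_gen f d).trans (hFC d))
    simp only [LinearMap.sum_apply, LinearMap.smul_apply, map_sum, map_smul, smul_eq_mul,
      Module.End.one_apply, Finset.sum_div] at h5
    rw [mul_div_assoc, div_self hg, mul_one] at h5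
    rw [← h5]
    apply Finset.sum_congr rfl
    intro k _
    rw [mul_div_assoc]
  refine ⟨fun k => g (CT f k v) / g v, ?_, ?_, hsum⟩
  · simp [CT_zero, div_self hg]
  · apply uniq_vec (fun k => descPochhammer ℂ k) (fun k => monic_descPochhammer ℂ k)
      (fun k => descPochhammer_natDegree ℂ k) N
    intro d
    rw [CT_gen, hFC, ← hsum, Finset.sum_smul]
    apply Finset.sum_congr rfl
    intro k _
    rw [smul_smul]

/-- the algebra map of the `r`-th tensor factor -/
def iotaR {n : ℕ} (V : Fin n → Type*) [∀ i, AddCommGroup (V i)] [∀ i, Module ℂ (V i)]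
    {M : Type*} [AddCommGroup M] [Module ℂ M] (φ : M ≃ₗ[ℂ] PiTensorProduct ℂ V) (r : Fin n) :
    Module.End ℂ (V r) →ₐ[ℂ] Module.End ℂ M :=
  AlgHom.ofLinearMap
    { toFun := fun a => φ.symm.toLinearMap ∘ₗ (PiTensorProduct.map
        (Function.update (fun i : Fin n => (LinearMap.id : V i →ₗ[ℂ] V i)) r a)) ∘ₗ φ.toLinearMap
      map_add' := by
        intro a b
        rw [PiTensorProduct.map_update_add, LinearMap.add_comp, LinearMap.comp_add]
      map_smul' := by
        intro c a
        rw [PiTensorProduct.map_update_smul, LinearMap.smul_comp, LinearMap.comp_smul]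
        rfl }
    (by
      change φ.symm.toLinearMap ∘ₗ (PiTensorProduct.map
        (Function.update (fun i : Fin n => (LinearMap.id : V i →ₗ[ℂ] V i)) r LinearMap.id)) ∘ₗ
          φ.toLinearMap = LinearMap.id
      rw [Function.update_eq_self_iff.mpr rfl, PiTensorProduct.map_id]
      ext x
      simp)
    (by
      intro a b
      have h : (Function.update (fun i : Fin n => (LinearMap.id : V i →ₗ[ℂ] V i)) r (a ∘ₗ b)) =
          fun i => (Function.update (fun i : Fin n => (LinearMap.id : V i →ₗ[ℂ] V i)) r a i) ∘ₗ
            (Function.update (fun i : Fin n => (LinearMap.id : V i →ₗ[ℂ] V i)) r b i) := by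
        funext i
        by_cases hi : i = r
        · subst hi; simp
        · simp [hi]
      change φ.symm.toLinearMap ∘ₗ (PiTensorProduct.map
        (Function.update (fun i : Fin n => (LinearMap.id : V i →ₗ[ℂ] V i)) r (a ∘ₗ b))) ∘ₗ
          φ.toLinearMap = _
      rw [h, PiTensorProduct.map_comp]
      ext x
      simp)

section
variable {M : Type*} [NormedAddCommGroup M] [NormedSpace ℂ M] [FiniteDimensional ℂ M]

lemma iter_exp (x : ℂ) (w : M) (k : ℕ) :
    iteratedDeriv k (fun t : ℂ => Complex.exp (x * t) • w) =
      fun t => x ^ k • (Complex.exp (x * t) • w) := by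
  induction k with
  | zero => simp
  | succ k ih =>
    rw [iteratedDeriv_succ, ih]
    funext t
    have h1 : HasDerivAt (fun t : ℂ => Complex.exp (x * t)) (Complex.exp (x * t) * x) t := by
      have := ((hasDerivAt_id t).const_mul x).cexp
      simpa using this
    have h2 := ((h1.smul_const w).const_smul (x ^ k)).deriv
    refine h2.trans ?_
    rw [smul_smul, smul_smul]
    congr 1
    ring

variable {n N : ℕ} (V : Fin n → Type*) [∀ i, AddCommGroup (V i)] [∀ i, Module ℂ (V i)]
  (E : ∀ i : Fin n, Fin N → Fin N → (V i →ₗ[ℂ] V i))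
  (φ : M ≃ₗ[ℂ] PiTensorProduct ℂ V) (z : Fin n → ℂ) (K : Fin N → ℂ)

lemma Dg_formula (f : ℂ → M) (hf : Differentiable ℂ f) (u : ℂ) (hu : GoodG z u) :
    Dg V M E φ z (Matrix.diagonal K) f u =
    ∑ k ∈ Finset.range (N + 1), ((Qc z).eval u ^ k)⁻¹ •
      ev u (PT z K (EE V M E φ) k) (iteratedDeriv (N - k) f u) := by
  unfold Dg PT
  simp only [map_sum, LinearMap.sum_apply, Finset.smul_sum]
  rw [Finset.sum_comm]
  apply Finset.sum_congr rfl
  intro σ _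
  have h := op_formula V E φ z K f hf (LL σ) u hu
  have h2 : (LL σ).map (fun p => Xg V M E φ z (Matrix.diagonal K) p.1 p.2) =
      List.ofFn fun a : Fin N => Xg V M E φ z (Matrix.diagonal K) a (σ a) := by
    rw [LL, List.map_ofFn]; rfl
  have h3 : (LL σ).length = N := by simp [LL]
  rw [h2, h3] at h
  rw [h, ← Int.cast_smul_eq_zsmul ℂ, Finset.smul_sum]
  apply Finset.sum_congr rfl
  intro k _
  rw [ev_smul, eval_C, LinearMap.smul_apply, smul_comm]
  rfl

lemma T_formula (𝒯 : ℕ → ℂ → Module.End ℂ M)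
    (h𝒯 : ∀ f : ℂ → M, Differentiable ℂ f → ∀ u : ℂ, GoodG z u →
      Dg V M E φ z (Matrix.diagonal K) f u =
        ∑ k ∈ Finset.range (N + 1), ((-1 : ℤ) ^ k) • 𝒯 k u (iteratedDeriv (N - k) f u))
    (u : ℂ) (hu : GoodG z u) (w : M) : ∀ k ≤ N,
    𝒯 k u w = (-1 : ℂ) ^ k • ((Qc z).eval u ^ k)⁻¹ • ev u (PT z K (EE V M E φ) k) w := by
  have key : ∀ k ≤ N, (-1 : ℂ) ^ k • 𝒯 k u w =
      ((Qc z).eval u ^ k)⁻¹ • ev u (PT z K (EE V M E φ) k) w := by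
    apply uniq_vec (fun k => (X : ℂ[X]) ^ k) (fun k => monic_X_pow k) (fun k => natDegree_X_pow k) N
    intro x
    have hd : Differentiable ℂ (fun t : ℂ => Complex.exp (x * t) • w) := by fun_prop
    have h := (h𝒯 _ hd u hu).symm.trans (Dg_formula V E φ z K _ hd u hu)
    simp only [iter_exp, map_smul] at h
    have h4 := congrArg (fun y => (Complex.exp (x * u))⁻¹ • y) h
    have hne := Complex.exp_ne_zero (x * u)
    simp only [Finset.smul_sum] at h4
    convert h4 using 1
    · apply Finset.sum_congr rfl
      intro k _
      rw [← Int.cast_smul_eq_zsmul ℂ]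
      simp only [smul_smul, eval_pow, eval_X]
      congr 1
      push_cast
      field_simp
    · apply Finset.sum_congr rfl
      intro k _
      simp only [smul_smul, eval_pow, eval_X]
      congr 1
      rw [← mul_assoc, ← mul_assoc, mul_assoc _ _ (Complex.exp _), mul_comm]
      field_simp
  intro k hk
  rw [← key k hk, smul_smul, ← mul_pow]
  simp
end

end Fin1

section Fin2
open Polynomial
/-- the polynomial on the right-hand side of the second identity at infinity -/
def qm {N : ℕ} (K : Fin N → ℂ) (m : Fin N → ℤ) : ℂ[X] :=
  - ∑ j : Fin N, C (m j : ℂ) * ∏ i ∈ Finset.univ.erase j, (X - C (K i))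

lemma qm_eval {N : ℕ} (K : Fin N → ℂ) (m : Fin N → ℤ) (x : ℂ) : (qm K m).eval x =
    - ∑ j : Fin N, (m j : ℂ) * ∏ i ∈ Finset.univ.erase j, (x - K i) := by
  simp [qm, eval_finsetSum, eval_prod]

lemma qm_deg {N : ℕ} (hN : 1 ≤ N) (K : Fin N → ℂ) (m : Fin N → ℤ) : (qm K m).natDegree < N := by
  rw [qm, natDegree_neg]
  refine lt_of_le_of_lt (natDegree_sum_le_of_forall_le (n := N - 1) _ _ ?_) (by omega)
  intro j _
  refine (natDegree_C_mul_le _ _).trans ?_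
  refine (natDegree_prod_le _ _).trans ?_
  simp

lemma poly_refl {N : ℕ} (q : ℂ[X]) (hq : q.natDegree < N + 1) (x : ℂ) :
    ∑ k ∈ Finset.range (N + 1), x ^ (N - k) * q.coeff (N - k) = q.eval x := by
  rw [eval_eq_sum_range' hq, ← Finset.sum_range_reflect]
  apply Finset.sum_congr rfl
  intro k hk
  have hk' : N - (N + 1 - 1 - k) = k := by
    have := Finset.mem_range.mp hk
    omega
  rw [mul_comm, hk']

lemma range_icc {N : ℕ} (f : ℕ → ℂ) :
    ∑ k ∈ Finset.range (N + 1), f k = f 0 + ∑ k ∈ Finset.Icc 1 N, f k := by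
  rw [Finset.range_eq_Ico, Finset.sum_eq_sum_Ico_succ_bot (by omega)]
  rfl

lemma alT_zero {N : ℕ} (K : Fin N → ℂ) : alT K 0 = 1 := by
  have h : ∀ k ≤ N, alT K k = (∏ i, (X - C (K i))).coeff (N - k) := by
    apply uniq_vec (fun k => (X : ℂ[X]) ^ k) (fun k => monic_X_pow k) (fun k => natDegree_X_pow k) N
    intro x
    simp only [eval_pow, eval_X, smul_eq_mul]
    rw [alT_gen, poly_refl _ (by rw [natDegree_finsetProd_X_sub_C_eq_card]; simp)]
    simp [eval_prod]
  rw [h 0 (Nat.zero_le _)]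
  have hm : (∏ i : Fin N, (X - C (K i))).Monic := monic_prod_X_sub_C _ _
  have hd : (∏ i : Fin N, (X - C (K i))).natDegree = N := by
    rw [natDegree_finsetProd_X_sub_C_eq_card]; simp
  have := hm.coeff_natDegree
  rwa [hd] at this

end Fin2

end GaudinModel

namespace GaudinModel

/-- Properties of the Gaudin transfer matrices `𝒯_k(u)` (the coefficients
of the universal differential operator `D_{K,M}(u,∂) = ∑ (−1)^k 𝒯_k(u) ∂^{N−k}` for a
diagonal matrix `K`), restricted to the weight subspace `M[m]`:
(i) the limits `𝒯_{k,0} = lim_{u→∞} 𝒯_k(u)`, `𝒯_{k,1} = lim_{u→∞} u(𝒯_k(u) − 𝒯_{k,0})`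
exist and are scalar operators `t0 k`, `t1 k` with
`x^N + ∑ (−1)^k t0_k x^{N−k} = ∏ (x − K_i)` and
`∑ (−1)^k t1_k x^{N−k} = −∑_j m_j ∏_{i≠j} (x − K_i)`;
(ii) `T̃_k(u) = ∏_s (u−z_s)^k 𝒯_k(u)` is a polynomial of degree ≤ nk, the operators
`c_{k,r} = T̃_k(z_r) ∏_{s≠r} (z_r−z_s)^{−k}` are scalars `c k r`, and for all `d ∈ ℂ`
`∑_{k=0}^N (−1)^k c_{k,r} ∏_{j=0}^{N−k−1} (d−j) = ∏_{i=1}^N (d − Λ^{(r)}_i − N + i)`. -/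
theorem statement_11
    {N n : ℕ} (hN : 2 ≤ N) (hn : 1 ≤ n)
    (V : Fin n → Type*) [∀ i, AddCommGroup (V i)] [∀ i, Module ℂ (V i)]
    [∀ i, FiniteDimensional ℂ (V i)]
    (M : Type*) [NormedAddCommGroup M] [NormedSpace ℂ M] [FiniteDimensional ℂ M]
    (Λ : Fin n → Fin N → ℤ)
    (hdom : ∀ i, ∀ a b : Fin N, a ≤ b → Λ i b ≤ Λ i a)
    (hpoly : ∀ i a, 0 ≤ Λ i a)
    (hlast : ∀ i, Λ i ⟨N - 1, by omega⟩ = 0)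
    (E : ∀ i : Fin n, Fin N → Fin N → (V i →ₗ[ℂ] V i))
    (hrel : GlRel V E)
    (hhw : IsHW V E Λ)
    (φ : M ≃ₗ[ℂ] PiTensorProduct ℂ V)
    (z : Fin n → ℂ) (hz : Function.Injective z)
    (K : Fin N → ℂ)
    (m : Fin N → ℤ)
    -- `𝒯 k` are the Gaudin transfer matrices:
    (𝒯 : ℕ → ℂ → Module.End ℂ M)
    (h𝒯 : ∀ f : ℂ → M, Differentiable ℂ f → ∀ u : ℂ, GoodG z u →
      Dg V M E φ z (Matrix.diagonal K) f u =
        ∑ k ∈ Finset.range (N + 1), ((-1 : ℤ) ^ k) • 𝒯 k u (iteratedDeriv (N - k) f u)) :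
    ∃ (t0 t1 : ℕ → ℂ) (c : ℕ → Fin n → ℂ) (P : ℕ → Polynomial (Module.End ℂ M)),
      -- (i) the limits exist and are the scalar operators `t0 k`, `t1 k` on `M[m]`
      (∀ k, 1 ≤ k → k ≤ N → ∀ w ∈ Wt V M E φ m,
        Filter.Tendsto (fun u : ℂ => 𝒯 k u w) (Bornology.cobounded ℂ)
          (nhds (t0 k • w)) ∧
        Filter.Tendsto (fun u : ℂ => u • (𝒯 k u w - t0 k • w)) (Bornology.cobounded ℂ)
          (nhds (t1 k • w))) ∧
      (∀ x : ℂ, x ^ N + ∑ k ∈ Finset.Icc 1 N, (-1 : ℂ) ^ k * t0 k * x ^ (N - k) =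
        ∏ i : Fin N, (x - K i)) ∧
      (∀ x : ℂ, ∑ k ∈ Finset.Icc 1 N, (-1 : ℂ) ^ k * t1 k * x ^ (N - k) =
        - ∑ j : Fin N, (m j : ℂ) * ∏ i ∈ Finset.univ.erase j, (x - K i)) ∧
      -- (ii) `T̃_k(u) = ∏_s (u − z_s)^k 𝒯_k(u)` is a polynomial of degree at most `nk` …
      (∀ k, 1 ≤ k → k ≤ N →
        (P k).natDegree ≤ n * k ∧
        (∀ u : ℂ, GoodG z u → ∀ w ∈ Wt V M E φ m,
          (∏ s : Fin n, (u - z s) ^ k) • 𝒯 k u w =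
            (P k).eval (u • (1 : Module.End ℂ M)) w) ∧
        -- … the operators `T̃_k(z_r) ∏_{s≠r} (z_r − z_s)^{−k}` are the scalars `c k r` …
        (∀ r : Fin n, ∀ w ∈ Wt V M E φ m,
          (P k).eval ((z r) • (1 : Module.End ℂ M)) w =
            (c k r * ∏ s ∈ Finset.univ.erase r, (z r - z s) ^ k) • w)) ∧
      (∀ r : Fin n, c 0 r = 1) ∧
      -- … and they satisfy the characteristic identity at each `z_r`
      (∀ r : Fin n, ∀ d : ℂ,
        ∑ k ∈ Finset.range (N + 1),
            (-1 : ℂ) ^ k * c k r * ∏ j ∈ Finset.range (N - k), (d - (j : ℕ)) =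
          ∏ i : Fin N, (d - (Λ r i : ℂ) - (N : ℂ) + ((i : ℕ) + 1 : ℕ))) := by
  classical
  letI := Polynomial.algebra (R := ℂ) (A := Module.End ℂ M)
  set e := EE V M E φ with he
  have hT := T_formula V E φ z K 𝒯 h𝒯
  have hcap : ∀ r : Fin n, ∃ c : ℕ → ℂ, c 0 = 1 ∧ (∀ k ≤ N, CT (R := Module.End ℂ (V r)) (E r) k = c k • 1) ∧
      ∀ d : ℂ, ∑ k ∈ Finset.range (N + 1), (descPochhammer ℂ (N - k)).eval d * c k =
        ∏ i : Fin N, (d - (N - 1 - (i : ℕ) : ℂ) - (Λ r i : ℂ)) := by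
    intro r
    obtain ⟨v, hv, h1, h2, h3⟩ := hhw r
    exact CT_scalar (E r) (fun a b c d => hrel r a b c d) (fun i => (Λ r i : ℂ)) v hv h1 h2 h3
  choose c hc0 hc1 hc2 using hcap
  have hw : ∀ w ∈ Wt V M E φ m, ∀ a, (∑ j, e j a a) w = (m a : ℂ) • w := by
    intro w hw a
    rw [Wt, Submodule.mem_iInf] at hw
    have := hw a
    rw [LinearMap.mem_ker, LinearMap.sub_apply, sub_eq_zero] at this
    exact this
  have hga : ∀ w ∈ Wt V M E φ m, ∀ k ≤ N, gaT K e k w = (qm K m).coeff (N - k) • w := by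
    intro w hwm
    apply uniq_vec (fun k => (Polynomial.X : Polynomial ℂ) ^ k)
      (fun k => Polynomial.monic_X_pow k) (fun k => Polynomial.natDegree_X_pow k) N
    intro x
    simp only [Polynomial.eval_pow, Polynomial.eval_X, smul_smul]
    rw [← Finset.sum_smul, poly_refl _ ((qm_deg (by omega) K m).trans (Nat.lt_succ_self N)), qm_eval]
    have h := LinearMap.congr_fun (gaT_gen K e x) w
    rw [LinearMap.sum_apply] at h
    simp only [LinearMap.smul_apply] at h
    rw [h, LinearMap.neg_apply, neg_smul, Finset.sum_smul, LinearMap.sum_apply]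
    congr 1
    apply Finset.sum_congr rfl
    intro i _
    rw [LinearMap.smul_apply, hw w hwm, smul_smul, mul_comm]
  have hsq : ∀ k : ℕ, (-1 : ℂ) ^ k * (-1 : ℂ) ^ k = 1 := by
    intro k; rw [← mul_pow]; simp
  have hinf := fun k => (AtInf_PT z K e hn k).smul ((-1 : ℂ) ^ k)
  refine ⟨fun k => (-1 : ℂ) ^ k * alT K k, fun k => (-1 : ℂ) ^ k * (qm K m).coeff (N - k),
    fun k r => (-1 : ℂ) ^ k * c r k,
    fun k => (Polynomial.C ((-1 : ℂ) ^ k) : Polynomial ℂ) • PT z K e k, ?_, ?_, ?_, ?_, ?_, ?_⟩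
  · intro k _ hk w hwm
    have h := (hinf k).lim (fun u => 𝒯 k u w) w (by
      intro u hu
      rw [hT u hu w k hk, ev_smul, Polynomial.eval_C, LinearMap.smul_apply, smul_comm])
    have e1 : ((-1 : ℂ) ^ k • algebraMap ℂ (Module.End ℂ M) (alT K k)) w =
        ((-1 : ℂ) ^ k * alT K k) • w := by
      rw [LinearMap.smul_apply, Module.algebraMap_end_apply, smul_smul]
    have e2 : ((-1 : ℂ) ^ k • gaT K e k) w = ((-1 : ℂ) ^ k * (qm K m).coeff (N - k)) • w := by
      rw [LinearMap.smul_apply, hga w hwm k hk, smul_smul]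
    rw [e1, e2] at h
    exact h
  · intro x
    rw [← alT_gen K x, range_icc, alT_zero, Nat.sub_zero, mul_one]
    congr 1
    apply Finset.sum_congr rfl
    intro k _
    rw [← mul_assoc, hsq, one_mul, mul_comm]
  · intro x
    rw [← qm_eval, ← poly_refl (N := N) _ ((qm_deg (by omega) K m).trans (Nat.lt_succ_self N)),
      range_icc, Nat.sub_zero, Polynomial.coeff_eq_zero_of_natDegree_lt (qm_deg (by omega) K m),
      mul_zero, zero_add]
    apply Finset.sum_congr rfl
    intro k _
    rw [← mul_assoc, hsq, one_mul, mul_comm]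
  · intro k _ hk
    refine ⟨(hinf k).natDegree, ?_, ?_⟩
    · intro u hu w _
      rw [← ev_apply, ev_smul, Polynomial.eval_C, LinearMap.smul_apply, hT u hu w k hk,
        Finset.prod_pow, ← Qc_eval, smul_comm, smul_inv_smul₀ (pow_ne_zero _ (Qc_ne hu))]
    · intro r w _
      rw [← ev_apply, ev_smul, Polynomial.eval_C,
        PT_eval z K e r (iotaR V φ r) (E r) (fun a b => rfl) k, hc1 r k hk, map_smul, map_one,
        Finset.prod_pow, LinearMap.smul_apply, LinearMap.smul_apply, LinearMap.smul_apply,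
        Module.End.one_apply, smul_smul, smul_smul, Qj_eval]
      congr 1
      ring
  · intro r
    simp [hc0]
  · intro r d
    have h := hc2 r d
    convert h using 1
    · apply Finset.sum_congr rfl
      intro k _
      rw [← mul_assoc, hsq, one_mul, mul_comm, descPochhammer_eval_eq_prod_range]
    · apply Finset.prod_congr rfl
      intro i _
      push_cast
      ring

end GaudinModel
end
end

section
/- Assume K = 0. Then for k = 1,…,N, restricted to sing M[m], the limit 𝒯_{k,0} = lim_{u→∞} u^k 𝒯_k(u) exists and is a scalar operator on sing M[m], and, setting 𝒯_{0,0} = 1, for every d ∈ ℂ: Σ_{k=0}^N (−1)^k 𝒯_{k,0} ∏_{j=0}^{N−k−1} (d − j) = ∏_{s=1}^N (d − m_s − N + s) · Id. -/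
noncomputable section

namespace GaudinModel

/-- `g` behaves like `u ^ p • h (1/u)` near infinity, with `h` analytic at `0`, `h 0 = v`. -/
def Asy {M : Type*} [NormedAddCommGroup M] [NormedSpace ℂ M] (p : ℤ) (v : M) (g : ℂ → M) : Prop :=
  ∃ h : ℂ → M, AnalyticAt ℂ h 0 ∧ h 0 = v ∧ ∃ R : ℝ, 0 < R ∧
    ∀ u : ℂ, R < ‖u‖ → g u = u ^ p • h u⁻¹

section AsyLemmas

variable {M : Type*} [NormedAddCommGroup M] [NormedSpace ℂ M]

theorem Asy.add {p : ℤ} {v w : M} {f g : ℂ → M} (hf : Asy p v f) (hg : Asy p w g) :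
    Asy p (v + w) (fun u => f u + g u) := by
  obtain ⟨h, ha, h0, R, hR, hh⟩ := hf
  obtain ⟨k, ka, k0, S, hS, hk⟩ := hg
  refine ⟨fun t => h t + k t, ha.fun_add ka, by simp [h0, k0], max R S, lt_max_of_lt_left hR, ?_⟩
  intro u hu
  beta_reduce
  rw [hh u ((le_max_left _ _).trans_lt hu), hk u ((le_max_right _ _).trans_lt hu), smul_add]

theorem Asy.zero (p : ℤ) : Asy p (0 : M) (fun _ => 0) :=
  ⟨fun _ => 0, analyticAt_const, rfl, 1, one_pos, by simp⟩

theorem Asy.sum {ι : Type*} (s : Finset ι) {p : ℤ} {v : ι → M} {f : ι → ℂ → M}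
    (hf : ∀ i ∈ s, Asy p (v i) (f i)) : Asy p (∑ i ∈ s, v i) (fun u => ∑ i ∈ s, f i u) := by
  classical
  induction s using Finset.induction_on with
  | empty => simpa using Asy.zero p
  | insert a s ha ih =>
    simp only [Finset.sum_insert ha]
    exact (hf a (Finset.mem_insert_self _ _)).add
      (ih fun i hi => hf i (Finset.mem_insert_of_mem hi))

theorem Asy.map [FiniteDimensional ℂ M] (L : Module.End ℂ M) {p : ℤ} {v : M} {f : ℂ → M}
    (hf : Asy p v f) : Asy p (L v) (fun u => L (f u)) := by
  obtain ⟨h, ha, h0, R, hR, hh⟩ := hf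
  refine ⟨fun t => L (h t), ?_, by simp [h0], R, hR, ?_⟩
  · exact ((LinearMap.toContinuousLinearMap L).analyticAt (h 0)).comp ha
  · intro u hu
    beta_reduce
    rw [hh u hu, map_smul]

theorem Asy.neg [FiniteDimensional ℂ M] {p : ℤ} {v : M} {f : ℂ → M}
    (hf : Asy p v f) : Asy p (-v) (fun u => -(f u)) := by
  simpa using hf.map (-1 : Module.End ℂ M)

theorem Asy.pole (z : ℂ) {p : ℤ} {v : M} {f : ℂ → M}
    (hf : Asy p v f) : Asy (p - 1) v (fun u => (u - z)⁻¹ • f u) := by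
  obtain ⟨h, ha, h0, R, hR, hh⟩ := hf
  refine ⟨fun t => (1 - z * t)⁻¹ • h t, ?_, by simp [h0], max R ‖z‖, lt_max_of_lt_left hR, ?_⟩
  · refine AnalyticAt.fun_smul (AnalyticAt.fun_inv (by fun_prop) (by simp)) ha
  · intro u hu
    have hu0 : u ≠ 0 := by
      rintro rfl
      simp only [norm_zero] at hu
      exact absurd (hR.trans_le (le_max_left R ‖z‖)) (not_lt.mpr hu.le)
    have huz : u - z ≠ 0 := by
      intro h
      rw [sub_eq_zero] at h
      subst h
      exact absurd hu (not_lt.mpr (le_max_right _ _))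
    beta_reduce
    rw [hh u ((le_max_left _ _).trans_lt hu), smul_smul, smul_smul]
    congr 1
    have : 1 - z * u⁻¹ = (u - z) * u⁻¹ := by field_simp
    rw [this, zpow_sub_one₀ hu0, mul_inv, inv_inv]
    field_simp

theorem Asy.deriv [FiniteDimensional ℂ M] {p : ℤ} {v : M} {f : ℂ → M}
    (hf : Asy p v f) : Asy (p - 1) ((p : ℂ) • v) (deriv f) := by
  haveI : CompleteSpace M := FiniteDimensional.complete ℂ M
  obtain ⟨h, ha, h0, R, hR, hh⟩ := hf
  obtain ⟨ε, hε, hball⟩ := Metric.eventually_nhds_iff.mp ha.eventually_analyticAt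
  refine ⟨fun t => (p : ℂ) • h t - t • _root_.deriv h t, ?_, by simp [h0], max R ε⁻¹,
    lt_max_of_lt_left hR, ?_⟩
  · exact (analyticAt_const.fun_smul ha).fun_sub (analyticAt_id.fun_smul ha.deriv)
  · intro u hu
    have huR : R < ‖u‖ := (le_max_left _ _).trans_lt hu
    have huε : ε⁻¹ < ‖u‖ := (le_max_right _ _).trans_lt hu
    have hu0 : u ≠ 0 := by
      rintro rfl
      simp only [norm_zero] at huR
      exact absurd hR (not_lt.mpr huR.le)
    have hev : f =ᶠ[nhds u] fun u => u ^ p • h u⁻¹ := by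
      filter_upwards [(isOpen_lt continuous_const continuous_norm).mem_nhds huR] with x hx
      exact hh x hx
    have hd : AnalyticAt ℂ h u⁻¹ := by
      apply hball
      rw [dist_zero_right, norm_inv]
      exact inv_lt_of_inv_lt₀ hε huε
    have h1 : HasDerivAt (fun u : ℂ => h u⁻¹) ((-(u ^ 2)⁻¹) • _root_.deriv h u⁻¹) u :=
      hd.differentiableAt.hasDerivAt.scomp u (hasDerivAt_inv hu0)
    have h2 := (hasDerivAt_zpow p u (Or.inl hu0)).fun_smul h1
    rw [hev.deriv_eq, h2.deriv, smul_sub, smul_smul, smul_smul, smul_smul, zpow_sub_one₀ hu0,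
      add_comm, sub_eq_add_neg, ← neg_smul]
    congr 2
    · ring
    · field_simp

theorem Asy.tendsto {p : ℤ} {v : M} {f : ℂ → M} (hf : Asy p v f) :
    Filter.Tendsto (fun u => u ^ (-p) • f u) (Bornology.cobounded ℂ) (nhds v) := by
  obtain ⟨h, ha, h0, R, hR, hh⟩ := hf
  have h1 : Filter.Tendsto (fun u : ℂ => h u⁻¹) (Bornology.cobounded ℂ) (nhds v) := by
    rw [← h0]
    exact ha.continuousAt.tendsto.comp Filter.tendsto_inv₀_cobounded
  refine h1.congr' ?_
  filter_upwards [tendsto_norm_cobounded_atTop.eventually (Filter.eventually_gt_atTop R)]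
    with u hu
  have hu0 : u ≠ 0 := by
    rintro rfl
    simp only [norm_zero] at hu
    exact absurd hR (not_lt.mpr hu.le)
  rw [hh u hu, smul_smul, ← zpow_add₀ hu0]
  simp

theorem Asy.pow (d : ℕ) (w : M) : Asy (d : ℤ) w (fun u => u ^ d • w) :=
  ⟨fun _ => w, analyticAt_const, rfl, 1, one_pos, by simp⟩

end AsyLemmas

section Lead

variable {N n : ℕ} (V : Fin n → Type*) [∀ i, AddCommGroup (V i)] [∀ i, Module ℂ (V i)]
  (M : Type*) [NormedAddCommGroup M] [NormedSpace ℂ M] [FiniteDimensional ℂ M]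
  (E : ∀ i : Fin n, Fin N → Fin N → (V i →ₗ[ℂ] V i))
  (φ : M ≃ₗ[ℂ] PiTensorProduct ℂ V)

theorem Asy.xg (z : Fin n → ℂ) (a b : Fin N) {p : ℤ} {v : M} {f : ℂ → M} (hf : Asy p v f) :
    Asy (p - 1) ((if a = b then (p : ℂ) • v else 0) - (∑ j : Fin n, EE V M E φ j b a) v)
      (Xg V M E φ z 0 a b f) := by
  have h1 : Asy (p - 1) (if a = b then (p : ℂ) • v else 0)
      (fun u => if a = b then _root_.deriv f u else 0) := by
    split_ifs
    · exact hf.deriv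
    · exact Asy.zero _
  have h2 := Asy.sum Finset.univ (p := p - 1) (v := fun j => EE V M E φ j b a v)
    (f := fun j u => (u - z j)⁻¹ • (EE V M E φ j b a) (f u))
    (fun j _ => (hf.map (EE V M E φ j b a)).pole (z j))
  have h3 := h1.add h2.neg
  have e : Xg V M E φ z 0 a b f = fun u => (if a = b then _root_.deriv f u else 0) +
      -∑ j : Fin n, (u - z j)⁻¹ • (EE V M E φ j b a) (f u) := by
    funext u
    simp [Xg, sub_eq_add_neg]
  rw [e, LinearMap.sum_apply, sub_eq_add_neg (ite _ _ _)]
  exact h3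

/-- leading coefficient of the composition of the `X_{ab}`. -/
def lead (p : ℤ) (v : M) : List (Fin N × Fin N) → M
  | [] => v
  | x :: l => (if x.1 = x.2 then ((p - l.length : ℤ) : ℂ) • lead p v l else 0)
      - (∑ j : Fin n, EE V M E φ j x.2 x.1) (lead p v l)

theorem asy_foldr (z : Fin n → ℂ) (l : List (Fin N × Fin N)) {p : ℤ} {v : M} {f : ℂ → M}
    (hf : Asy p v f) :
    Asy (p - l.length) (lead V M E φ p v l)
      ((l.map fun x => Xg V M E φ z 0 x.1 x.2).foldr (· ∘ ·) id f) := by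
  induction l with
  | nil => simpa [lead] using hf
  | cons x l ih =>
    have := Asy.xg V M E φ z x.1 x.2 ih
    simp only [List.map_cons, List.foldr_cons, Function.comp_apply, lead, List.length_cons]
    convert this using 1
    push_cast
    ring

theorem lead_diag (m : Fin N → ℤ) (w : M)
    (hw : ∀ a, (∑ j : Fin n, EE V M E φ j a a) w = (m a : ℂ) • w) (p : ℤ) (k : ℕ)
    (g : Fin k → Fin N) :
    lead V M E φ p w (List.ofFn fun i => (g i, g i)) =
      (∏ s : Fin k, ((p : ℂ) - (m (g s) : ℂ) - (k : ℂ) + ((s : ℕ) + 1 : ℕ))) • w := by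
  induction k with
  | zero => simp [lead]
  | succ k ih =>
    rw [List.ofFn_succ, lead, ih (fun i => g i.succ), Fin.prod_univ_succ]
    simp only [map_smul, hw, List.length_ofFn, if_true, smul_smul, ← sub_smul]
    congr 1
    have : ∀ s : Fin k, ((p : ℂ) - (m (g s.succ) : ℂ) - ((k + 1 : ℕ) : ℂ) +
        (((s.succ : Fin (k + 1)) : ℕ) + 1 : ℕ)) =
        ((p : ℂ) - (m (g s.succ) : ℂ) - (k : ℂ) + ((s : ℕ) + 1 : ℕ)) := by
      intro s
      push_cast [Fin.val_succ]
      ring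
    simp only [this]
    push_cast
    simp only [Fin.val_zero, Nat.cast_zero]
    ring

theorem lead_diag_list (m : Fin N → ℤ) (w : M)
    (hw : ∀ a, (∑ j : Fin n, EE V M E φ j a a) w = (m a : ℂ) • w) (p : ℤ)
    (l : List (Fin N × Fin N)) (hl : ∀ x ∈ l, x.1 = x.2) :
    ∃ c : ℂ, lead V M E φ p w l = c • w := by
  induction l with
  | nil => exact ⟨1, by simp [lead]⟩
  | cons x l ih =>
    obtain ⟨c, hc⟩ := ih fun y hy => hl y (List.mem_cons_of_mem _ hy)
    have hx := hl x List.mem_cons_self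
    refine ⟨((p - l.length : ℤ) : ℂ) * c - c * (m x.2 : ℂ), ?_⟩
    rw [lead, hc, if_pos hx, hx, map_smul, hw, smul_smul, smul_smul, sub_smul]

theorem lead_append_zero (p : ℤ) (w : M) (l l' : List (Fin N × Fin N))
    (h : lead V M E φ p w l' = 0) : lead V M E φ p w (l ++ l') = 0 := by
  induction l with
  | nil => simpa using h
  | cons x l ih => simp [lead, ih]

theorem lead_perm (m : Fin N → ℤ) (w : M)
    (hw : ∀ a, (∑ j : Fin n, EE V M E φ j a a) w = (m a : ℂ) • w)
    (hs : ∀ a b, a < b → (∑ j : Fin n, EE V M E φ j a b) w = 0) (p : ℤ)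
    (σ : Equiv.Perm (Fin N)) (hσ : σ ≠ 1) :
    lead V M E φ p w (List.ofFn fun i => (i, σ i)) = 0 := by
  classical
  have hne : (Finset.univ.filter fun a => σ a ≠ a).Nonempty := by
    by_contra h
    rw [Finset.not_nonempty_iff_eq_empty, Finset.filter_eq_empty_iff] at h
    apply hσ
    ext a
    have := h (Finset.mem_univ a)
    simp only [not_not] at this
    simp [this]
  obtain ⟨a, ha, hmax⟩ := Finset.exists_max_image _ id hne
  have ha' : σ a ≠ a := (Finset.mem_filter.mp ha).2
  have hfix : ∀ b, a < b → σ b = b := by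
    intro b hb
    by_contra h
    exact absurd (hmax b (Finset.mem_filter.mpr ⟨Finset.mem_univ _, h⟩)) (not_le.mpr hb)
  have hlt : σ a < a := by
    rcases lt_trichotomy (σ a) a with h | h | h
    · exact h
    · exact absurd h ha'
    · exact absurd (σ.injective (hfix _ h)) ha'
  obtain ⟨l1, l2, hl⟩ := List.append_of_mem (List.mem_finRange a)
  have hsorted := List.pairwise_lt_finRange N
  rw [hl, List.pairwise_append, List.pairwise_cons] at hsorted
  have e : (List.ofFn fun i => (i, σ i)) =
      (l1.map fun i => (i, σ i)) ++ (a, σ a) :: (l2.map fun i => (i, σ i)) := by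
    rw [List.ofFn_eq_map, hl, List.map_append, List.map_cons]
  rw [e]
  apply lead_append_zero
  obtain ⟨c, hc⟩ := lead_diag_list V M E φ m w hw p (l2.map fun i => (i, σ i)) (by
    intro x hx
    obtain ⟨i, hi, rfl⟩ := List.mem_map.mp hx
    exact (hfix i (hsorted.2.1.1 i hi)).symm)
  rw [lead, hc, if_neg (fun h => ha' h.symm), map_smul, hs _ _ hlt]
  simp

theorem asy_Dg (z : Fin n → ℂ) (m : Fin N → ℤ) (w : M)
    (hw : ∀ a, (∑ j : Fin n, EE V M E φ j a a) w = (m a : ℂ) • w)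
    (hs : ∀ a b, a < b → (∑ j : Fin n, EE V M E φ j a b) w = 0) (d : ℕ) :
    Asy ((d : ℤ) - N)
      ((∏ s : Fin N, ((d : ℂ) - (m s : ℂ) - (N : ℂ) + ((s : ℕ) + 1 : ℕ))) • w)
      (Dg V M E φ z 0 fun u => u ^ d • w) := by
  have key : ∀ σ : Equiv.Perm (Fin N), Asy ((d : ℤ) - N)
      ((((Equiv.Perm.sign σ : ℤˣ) : ℤ) : ℂ) •
        lead V M E φ d w (List.ofFn fun i => (i, σ i)))
      (fun u => ((Equiv.Perm.sign σ : ℤˣ) : ℤ) •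
      (((List.ofFn fun a : Fin N => Xg V M E φ z 0 a (σ a)).foldr (· ∘ ·) id)
        (fun u => u ^ d • w) u)) := by
    intro σ
    have h := asy_foldr V M E φ z (List.ofFn fun i => (i, σ i)) (Asy.pow d w)
    rw [List.length_ofFn, List.map_ofFn] at h
    have h' := h.map ((((Equiv.Perm.sign σ : ℤˣ) : ℤ) : ℂ) • (1 : Module.End ℂ M))
    simp only [LinearMap.smul_apply, Module.End.one_apply, Int.cast_smul_eq_zsmul] at h' ⊢
    exact h'
  have h := Asy.sum Finset.univ fun σ _ => key σ
  rw [Finset.sum_eq_single 1] at h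
  · have h1 := lead_diag V M E φ m w hw d N id
    simp only [id] at h1
    simp only [Equiv.Perm.sign_one, Units.val_one, Int.cast_one, one_smul,
      Equiv.Perm.one_apply] at h
    rw [h1] at h
    simp only [Int.cast_natCast] at h
    exact h
  · intro σ _ hσ
    rw [lead_perm V M E φ m w hw hs d σ hσ, smul_zero]
  · simp

end Lead

theorem falling_expansion (N : ℕ) (x : Fin N → ℂ) : ∃ c : ℕ → ℂ, c N = 1 ∧ (∀ k, N < k → c k = 0) ∧
    ∀ d : ℂ, ∏ s : Fin N, (d - x s) =
      ∑ k ∈ Finset.range (N + 1), c k * ∏ j ∈ Finset.range k, (d - (j : ℕ)) := by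
  induction N with
  | zero => exact ⟨fun k => if k = 0 then 1 else 0, by simp, fun k hk => if_neg (by omega), by simp⟩
  | succ N ih =>
    obtain ⟨c, c1, c0, hc⟩ := ih fun s => x s.succ
    refine ⟨fun k => (if k = 0 then 0 else c (k - 1)) + (k - x 0) * c k, ?_, ?_, ?_⟩
    · simp [c1, c0 (N + 1) (by omega)]
    · intro k hk
      simp [c0 k (by omega), c0 (k - 1) (by omega)]
    · intro d
      rw [Fin.prod_univ_succ, hc]
      simp only [add_mul, Finset.sum_add_distrib]
      rw [Finset.sum_range_succ' (fun k => (if k = 0 then 0 else c (k - 1)) * _),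
        Finset.sum_range_succ (fun k => ((k : ℂ) - x 0) * c k * _) (N + 1), c0 (N + 1) (by omega)]
      simp only [if_true, zero_mul, mul_zero, add_zero, Nat.add_eq_zero_iff, one_ne_zero,
        and_false, if_false, Nat.add_sub_cancel]
      rw [← Finset.sum_add_distrib, Finset.mul_sum]
      refine Finset.sum_congr rfl fun k _ => ?_
      rw [Finset.prod_range_succ]
      ring

theorem iter_pow {M : Type*} [NormedAddCommGroup M] [NormedSpace ℂ M] (d i : ℕ) (w : M) :
    iteratedDeriv i (fun u : ℂ => u ^ d • w) =
      fun u => ((∏ j ∈ Finset.range i, ((d : ℂ) - (j : ℕ))) * u ^ (d - i)) • w := by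
  induction i with
  | zero => simp
  | succ i ih =>
    rw [iteratedDeriv_succ, ih]
    funext u
    have h := (((hasDerivAt_pow (d - i) u).const_mul
      (∏ j ∈ Finset.range i, ((d : ℂ) - (j : ℕ)))).smul_const w).deriv
    rw [h, Finset.prod_range_succ]
    congr 1
    rw [Nat.sub_sub]
    rcases le_or_gt i d with hi | hi
    · rw [Nat.cast_sub hi]; ring
    · rw [Finset.prod_eq_zero (Finset.mem_range.mpr hi) (sub_self _)]; ring

theorem triangular {M : Type*} [NormedAddCommGroup M] [NormedSpace ℂ M] (N : ℕ)
    (F : Filter ℂ) (G : ℕ → ℂ → M) (L : ℕ → M)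
    (h : ∀ d ≤ N, Filter.Tendsto (fun u => ∑ i ∈ Finset.range (N + 1),
      (∏ j ∈ Finset.range i, ((d : ℂ) - (j : ℕ))) • G i u) F
      (nhds (∑ i ∈ Finset.range (N + 1), (∏ j ∈ Finset.range i, ((d : ℂ) - (j : ℕ))) • L i))) :
    ∀ d ≤ N, Filter.Tendsto (G d) F (nhds (L d)) := by
  intro d
  induction d using Nat.strong_induction_on with
  | _ d ih =>
    intro hd
    have trunc : ∀ H : ℕ → M, ∑ i ∈ Finset.range (N + 1),
        (∏ j ∈ Finset.range i, ((d : ℂ) - (j : ℕ))) • H i =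
        ∑ i ∈ Finset.range d, (∏ j ∈ Finset.range i, ((d : ℂ) - (j : ℕ))) • H i +
        (∏ j ∈ Finset.range d, ((d : ℂ) - (j : ℕ))) • H d := by
      intro H
      rw [← Finset.sum_range_succ (fun i => (∏ j ∈ Finset.range i, ((d : ℂ) - (j : ℕ))) • H i)]
      symm
      apply Finset.sum_subset
      · intro i
        simp only [Finset.mem_range]
        omega
      · intro i _ hi
        simp only [Finset.mem_range, not_lt] at hi
        rw [Finset.prod_eq_zero (Finset.mem_range.mpr hi) (sub_self _), zero_smul]
    have h1 := h d hd
    simp only [trunc] at h1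
    have h2 : Filter.Tendsto (fun u => ∑ i ∈ Finset.range d,
        (∏ j ∈ Finset.range i, ((d : ℂ) - (j : ℕ))) • G i u) F
        (nhds (∑ i ∈ Finset.range d, (∏ j ∈ Finset.range i, ((d : ℂ) - (j : ℕ))) • L i)) := by
      refine tendsto_finsetSum _ fun i hi => ?_
      have hi' := Finset.mem_range.mp hi
      exact (ih i hi' (by omega)).const_smul _
    have hne : (∏ j ∈ Finset.range d, ((d : ℂ) - (j : ℕ))) ≠ 0 := by
      rw [Finset.prod_ne_zero_iff]
      intro j hj
      rw [sub_ne_zero]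
      exact_mod_cast (Finset.mem_range.mp hj).ne'
    have h3 := (h1.sub h2).const_smul (∏ j ∈ Finset.range d, ((d : ℂ) - (j : ℕ)))⁻¹
    simpa only [add_sub_cancel_left, smul_smul, inv_mul_cancel₀ hne, one_smul] using h3

/-- Assume `K = 0`.  For `k = 1, …, N`, restricted to `sing M[m]`, the
limit `𝒯_{k,0} = lim_{u→∞} u^k 𝒯_k(u)` exists and is a scalar operator `t0 k`, and with
`t0 0 = 1`, for every `d ∈ ℂ`,
`∑_{k=0}^N (−1)^k t0_k ∏_{j=0}^{N−k−1} (d − j) = ∏_{s=1}^N (d − m_s − N + s)`. -/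
theorem statement_12
    {N n : ℕ} (hN : 2 ≤ N) (hn : 1 ≤ n)
    (V : Fin n → Type*) [∀ i, AddCommGroup (V i)] [∀ i, Module ℂ (V i)]
    [∀ i, FiniteDimensional ℂ (V i)]
    (M : Type*) [NormedAddCommGroup M] [NormedSpace ℂ M] [FiniteDimensional ℂ M]
    (Λ : Fin n → Fin N → ℤ)
    (hdom : ∀ i, ∀ a b : Fin N, a ≤ b → Λ i b ≤ Λ i a)
    (hpoly : ∀ i a, 0 ≤ Λ i a)
    (hlast : ∀ i, Λ i ⟨N - 1, by omega⟩ = 0)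
    (E : ∀ i : Fin n, Fin N → Fin N → (V i →ₗ[ℂ] V i))
    (hrel : GlRel V E)
    (hhw : IsHW V E Λ)
    (φ : M ≃ₗ[ℂ] PiTensorProduct ℂ V)
    (z : Fin n → ℂ) (hz : Function.Injective z)
    (m : Fin N → ℤ)
    -- `𝒯 k` are the Gaudin transfer matrices for `K = 0`:
    (𝒯 : ℕ → ℂ → Module.End ℂ M)
    (h𝒯 : ∀ f : ℂ → M, Differentiable ℂ f → ∀ u : ℂ, GoodG z u →
      Dg V M E φ z (0 : Matrix (Fin N) (Fin N) ℂ) f u =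
        ∑ k ∈ Finset.range (N + 1), ((-1 : ℤ) ^ k) • 𝒯 k u (iteratedDeriv (N - k) f u)) :
    ∃ t0 : ℕ → ℂ, t0 0 = 1 ∧
      (∀ k, 1 ≤ k → k ≤ N → ∀ w ∈ SingWt V M E φ m,
        Filter.Tendsto (fun u : ℂ => (u ^ k) • 𝒯 k u w) (Bornology.cobounded ℂ)
          (nhds (t0 k • w))) ∧
      (∀ d : ℂ, ∑ k ∈ Finset.range (N + 1),
          (-1 : ℂ) ^ k * t0 k * ∏ j ∈ Finset.range (N - k), (d - (j : ℕ)) =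
        ∏ s : Fin N, (d - (m s : ℂ) - (N : ℂ) + ((s : ℕ) + 1 : ℕ))) := by
  obtain ⟨c, c1, -, hc⟩ := falling_expansion N
    (fun s : Fin N => (m s : ℂ) + (N : ℂ) - ((s : ℕ) + 1 : ℕ))
  have hc' : ∀ d : ℂ, ∏ s : Fin N, (d - (m s : ℂ) - (N : ℂ) + ((s : ℕ) + 1 : ℕ)) =
      ∑ k ∈ Finset.range (N + 1), c k * ∏ j ∈ Finset.range k, (d - (j : ℕ)) := by
    intro d
    rw [← hc]
    exact Finset.prod_congr rfl fun s _ => by ring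
  have sgn : ∀ k : ℕ, (-1 : ℂ) ^ k * (-1 : ℂ) ^ k = 1 := by
    intro k
    rw [← mul_pow]
    simp
  refine ⟨fun k => (-1 : ℂ) ^ k * c (N - k), by simp [c1], ?_, ?_⟩
  · intro k hk1 hkN w hw
    obtain ⟨hwt, hsing⟩ := Submodule.mem_inf.mp hw
    have hw1 : ∀ a, (∑ j : Fin n, EE V M E φ j a a) w = (m a : ℂ) • w := by
      intro a
      have := (Submodule.mem_iInf _).mp hwt a
      rw [LinearMap.mem_ker, LinearMap.sub_apply, sub_eq_zero] at this
      simpa using this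
    have hs1 : ∀ a b, a < b → (∑ j : Fin n, EE V M E φ j a b) w = 0 := by
      intro a b hab
      simp only [Submodule.mem_iInf] at hsing
      exact LinearMap.mem_ker.mp (hsing a b hab)
    have T := triangular N (Bornology.cobounded ℂ)
      (fun i u => ((-1 : ℂ) ^ (N - i) * u ^ (N - i)) • 𝒯 (N - i) u w) (fun i => c i • w) (by
        intro d hd
        have h1 := (asy_Dg V M E φ z m w hw1 hs1 d).tendsto
        have e1 : (∏ s : Fin N, ((d : ℂ) - (m s : ℂ) - (N : ℂ) + ((s : ℕ) + 1 : ℕ))) • w =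
            ∑ i ∈ Finset.range (N + 1),
              (∏ j ∈ Finset.range i, ((d : ℂ) - (j : ℕ))) • c i • w := by
          rw [hc', Finset.sum_smul]
          exact Finset.sum_congr rfl fun i _ => by rw [smul_smul, mul_comm]
        rw [e1] at h1
        refine h1.congr' ?_
        have hgood : ∀ᶠ u in Bornology.cobounded ℂ, GoodG z u := by
          unfold GoodG
          rw [Filter.eventually_all]
          intro j
          filter_upwards [tendsto_norm_cobounded_atTop.eventually
            (Filter.eventually_gt_atTop ‖z j‖)] with u hu he
          rw [he] at hu
          exact lt_irrefl _ hu
        filter_upwards [hgood] with u hu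
        rw [h𝒯 _ (by fun_prop) u hu, ← Finset.sum_range_reflect, Finset.smul_sum]
        refine Finset.sum_congr rfl fun i hi => ?_
        have hi' := Finset.mem_range.mp hi
        have e2 : N + 1 - 1 - i = N - i := by omega
        have e3 : N - (N - i) = i := by omega
        rw [e2, e3, iter_pow, ← Int.cast_smul_eq_zsmul ℂ, map_smul, smul_smul, smul_smul,
          smul_smul]
        congr 1
        rcases le_or_gt i d with hid | hid
        · have e4 : -((d : ℤ) - N) = ((N - d : ℕ) : ℤ) := by omega
          rw [e4, zpow_natCast]
          have e5 : N - i = (N - d) + (d - i) := by omega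
          rw [show u ^ (N - i) = u ^ (N - d) * u ^ (d - i) by rw [← pow_add, e5]]
          push_cast
          ring
        · rw [Finset.prod_eq_zero (Finset.mem_range.mpr hid) (sub_self _)]
          ring)
    have h1 := (T (N - k) (by omega)).const_smul ((-1 : ℂ) ^ k)
    have e3 : N - (N - k) = k := by omega
    simp only [e3, smul_smul, ← mul_assoc, sgn, one_mul] at h1
    exact h1
  · intro d
    rw [hc', ← Finset.sum_range_reflect]
    refine Finset.sum_congr rfl fun i hi => ?_
    have hi' := Finset.mem_range.mp hi
    have e2 : N + 1 - 1 - i = N - i := by omega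
    have e3 : N - (N - i) = i := by omega
    simp only [e2, e3]
    rw [← mul_assoc, sgn, one_mul]

end GaudinModel
end
end

section
/- If a nonzero V-valued quasi-exponential of the form e^{λu} (u^m v_m + u^{m−1} v_{m−1} + … + v_0), with λ ∈ ℂ and v_0,…,v_m ∈ V, lies in the kernel of the admissible-at-infinity differential operator D, then λ is a root of the characteristic equation of D, i.e. det(λ^N + λ^{N−1} A_{1,0} + … + λ A_{N−1,0} + A_{N,0}) = 0. -/
noncomputable section

open Filter Topology in
theorem aux_deriv {V : Type*} [NormedAddCommGroup V] [NormedSpace ℂ V] (lam : ℂ) (M : ℕ)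
    (w : ℕ → V) (hw : ∀ j, M < j → w j = 0) (x : ℂ) :
    HasDerivAt (fun x : ℂ => Complex.exp (lam * x) • ∑ j ∈ Finset.range (M + 1), (x ^ j) • w j)
      (Complex.exp (lam * x) • ∑ j ∈ Finset.range (M + 1),
        (x ^ j) • (lam • w j + ((j : ℂ) + 1) • w (j + 1))) x := by
  have h1 : HasDerivAt (fun x : ℂ => Complex.exp (lam * x)) (Complex.exp (lam * x) * lam) x := by
    simpa using ((hasDerivAt_id x).const_mul lam).cexp
  have h2 : HasDerivAt (fun x : ℂ => ∑ j ∈ Finset.range (M + 1), (x ^ j) • w j)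
      (∑ j ∈ Finset.range (M + 1), ((j : ℂ) * x ^ (j - 1)) • w j) x := by
    apply HasDerivAt.fun_sum
    intro j _
    exact (hasDerivAt_pow j x).smul_const (w j)
  have h3 : ∑ j ∈ Finset.range (M + 1), ((j : ℂ) * x ^ (j - 1)) • w j
      = ∑ j ∈ Finset.range (M + 1), (x ^ j) • (((j : ℂ) + 1) • w (j + 1)) := by
    rw [Finset.sum_range_succ', Finset.sum_range_succ _ M, hw (M + 1) (by omega)]
    simp [smul_smul, mul_comm]
  have h4 := h1.smul h2
  refine h4.congr_deriv ?_
  symm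
  rw [h3]
  simp only [smul_add, Finset.sum_add_distrib, mul_smul, Finset.smul_sum]
  rw [add_comm]
  congr 1
  apply Finset.sum_congr rfl
  intro j _
  rw [smul_comm lam]

theorem aux_iter {V : Type*} [NormedAddCommGroup V] [NormedSpace ℂ V] (lam : ℂ) (M : ℕ)
    (v : ℕ → V) (hv : ∀ j, M < j → v j = 0) (n : ℕ) :
    ∃ w : ℕ → V, (∀ j, M < j → w j = 0) ∧ w M = lam ^ n • v M ∧
      iteratedDeriv n
        (fun x : ℂ => Complex.exp (lam * x) • ∑ j ∈ Finset.range (M + 1), (x ^ j) • v j)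
      = fun x : ℂ => Complex.exp (lam * x) • ∑ j ∈ Finset.range (M + 1), (x ^ j) • w j := by
  induction n with
  | zero => exact ⟨v, hv, by simp, by simp⟩
  | succ n ih =>
    obtain ⟨w, hw, hM, hd⟩ := ih
    refine ⟨fun j => lam • w j + ((j : ℂ) + 1) • w (j + 1), ?_, ?_, ?_⟩
    · intro j hj
      simp [hw j hj, hw (j + 1) (by omega)]
    · simp [hM, hw (M + 1) (by omega), smul_smul, pow_succ']
    · rw [iteratedDeriv_succ, hd]
      funext x
      exact (aux_deriv lam M w hw x).deriv

/-- If a nonzero `V`-valued quasi-exponential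
`e^{λu} (u^m v_m + … + v_0)` lies in the kernel of the admissible-at-infinity differential
operator `D = ∑_{k=0}^N A_k(u) ∂^{N−k}` (with `A_0 = 1`, rational coefficients with finite
limits `L k` at infinity), then `λ` is a root of the characteristic equation
`det (λ^N + λ^{N−1} A_{1,0} + … + λ A_{N−1,0} + A_{N,0}) = 0`. -/
theorem statement_14
    (V : Type*) [NormedAddCommGroup V] [NormedSpace ℂ V] [FiniteDimensional ℂ V]
    (N : ℕ) (hN : 1 ≤ N)
    (A : ℕ → ℂ → Module.End ℂ V)
    (hA0 : ∀ u, A 0 u = LinearMap.id)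
    (hrat : ∀ k ≤ N, ∃ (P : Polynomial (Module.End ℂ V)) (q : Polynomial ℂ), q ≠ 0 ∧
      ∀ u : ℂ, q.eval u ≠ 0 → A k u = (q.eval u)⁻¹ • P.eval (u • (1 : Module.End ℂ V)))
    (L : ℕ → Module.End ℂ V)
    (hL0 : L 0 = LinearMap.id)
    (hlim : ∀ k ≤ N, ∀ w : V,
      Filter.Tendsto (fun u => A k u w) (Bornology.cobounded ℂ) (nhds (L k w)))
    (lam : ℂ)
    (m : ℕ) (v : ℕ → V) (hv : ∃ j ≤ m, v j ≠ 0)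
    (S : Finset ℂ)
    (hker : ∀ u : ℂ, u ∉ S →
      ∑ k ∈ Finset.range (N + 1),
        A k u (iteratedDeriv (N - k)
          (fun x => Complex.exp (lam * x) •
            ∑ j ∈ Finset.range (m + 1), (x ^ j) • v j) u) = 0) :
    LinearMap.det (∑ k ∈ Finset.range (N + 1), lam ^ (N - k) • L k) = 0 := by
  classical
  have hex : ∃ M, M ≤ m ∧ v M ≠ 0 ∧ ∀ j, M < j → j ≤ m → v j = 0 := by
    obtain ⟨j0, hj0, hvj0⟩ := hv
    have hne : ((Finset.range (m + 1)).filter (fun j => v j ≠ 0)).Nonempty :=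
      ⟨j0, by simp [hvj0]; omega⟩
    have hmem := Finset.max'_mem _ hne
    rw [Finset.mem_filter, Finset.mem_range] at hmem
    refine ⟨_, by omega, hmem.2, ?_⟩
    intro j hj hjm
    by_contra hc
    have := Finset.le_max' ((Finset.range (m + 1)).filter (fun j => v j ≠ 0)) j
      (by simp [hc]; omega)
    omega
  obtain ⟨M, hMm, hvM, hvan⟩ := hex
  set v' : ℕ → V := fun j => if j ≤ M then v j else 0 with hv'
  have hfun : (fun x : ℂ => Complex.exp (lam * x) • ∑ j ∈ Finset.range (m + 1), (x ^ j) • v j)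
      = fun x : ℂ => Complex.exp (lam * x) • ∑ j ∈ Finset.range (M + 1), (x ^ j) • v' j := by
    funext x
    congr 1
    symm
    have hs : Finset.range (M + 1) ⊆ Finset.range (m + 1) := by
      intro j; simp only [Finset.mem_range]; omega
    rw [← Finset.sum_subset hs (f := fun j => (x ^ j) • v j)]
    · apply Finset.sum_congr rfl
      intro j hj
      have : j ≤ M := by simpa [Nat.lt_succ_iff] using hj
      simp [hv', this]
    · intro j hj hj2
      simp only [Finset.mem_range] at hj hj2
      rw [hvan j (by omega) (by omega), smul_zero]
  rw [hfun] at hker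
  have hit := fun n => aux_iter lam M v' (fun j hj => by simp [hv', not_le.2 hj]) n
  choose w hw0 hwM hwd using hit
  have hvM' : v' M = v M := by simp [hv']
  have hT : Filter.Tendsto (fun u : ℂ => ∑ k ∈ Finset.range (N + 1),
      ∑ j ∈ Finset.range (M + 1), ((u⁻¹) ^ (M - j)) • A k u (w (N - k) j))
      (Bornology.cobounded ℂ)
      (nhds (∑ k ∈ Finset.range (N + 1), ∑ j ∈ Finset.range (M + 1),
        ((0 : ℂ) ^ (M - j)) • L k (w (N - k) j))) := by
    apply tendsto_finsetSum
    intro k hk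
    apply tendsto_finsetSum
    intro j hj
    exact (Filter.tendsto_inv₀_cobounded.pow _).smul
      (hlim k (by simpa [Nat.lt_succ_iff] using hk) _)
  have hE : ∀ᶠ u : ℂ in Bornology.cobounded ℂ, ∑ k ∈ Finset.range (N + 1),
      ∑ j ∈ Finset.range (M + 1), ((u⁻¹) ^ (M - j)) • A k u (w (N - k) j) = 0 := by
    have h1 : ∀ᶠ u : ℂ in Bornology.cobounded ℂ, u ∉ S :=
      Bornology.isBounded_def.1 (S.finite_toSet.isBounded)
    have h2 : ∀ᶠ u : ℂ in Bornology.cobounded ℂ, u ∉ ({0} : Set ℂ) :=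
      Bornology.isBounded_def.1 Bornology.isBounded_singleton
    filter_upwards [h1, h2] with u hu hu0
    have hu0 : u ≠ 0 := by simpa using hu0
    have h := hker u hu
    simp only [hwd, map_smul, ← Finset.smul_sum] at h
    have h := (smul_eq_zero.1 h).resolve_left (Complex.exp_ne_zero _)
    have h : (u⁻¹) ^ M • _ = (u⁻¹) ^ M • (0 : V) := congrArg (fun z => (u⁻¹) ^ M • z) h
    rw [smul_zero] at h
    rw [← h, Finset.smul_sum]
    apply Finset.sum_congr rfl
    intro k _
    rw [map_sum, Finset.smul_sum]
    apply Finset.sum_congr rfl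
    intro j hj
    have hj : j ≤ M := by simpa [Nat.lt_succ_iff] using hj
    rw [map_smul, smul_smul]
    congr 1
    rw [inv_pow, inv_pow]
    rw [pow_sub₀ u hu0 hj]
    field_simp
  have hz := tendsto_nhds_unique (hT.congr' hE) tendsto_const_nhds
  have hz2 : (∑ k ∈ Finset.range (N + 1), lam ^ (N - k) • L k) (v M) = 0 := by
    rw [← hz, LinearMap.sum_apply]
    apply Finset.sum_congr rfl
    intro k _
    rw [Finset.sum_range_succ, Finset.sum_eq_zero]
    · simp [hwM, hvM']
    · intro j hj
      have : M - j ≠ 0 := by have := Finset.mem_range.1 hj; omega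
      simp [zero_pow this]
  by_contra hdet
  have hu := (LinearMap.equivOfDetNeZero _ hdet).injective
  apply hvM
  apply hu
  rw [map_zero]
  exact hz2
end
end

section
/- Let a_1,…,a_n be nonnegative integers and C(u) = ∏_{j=1}^n (u − z_j)^{a_j}. Let D'(u,∂) be the universal differential operator built exactly as D_{K,M}(u,∂) but with each e_{ba}^{(j)} replaced by e_{ba}^{(j)} + a_j δ_{ab} (this is the universal differential operator associated with K and the twisted tensor product M_{Λ^{(1)}(a_1)}(z_1) ⊗ … ⊗ M_{Λ^{(n)}(a_n)}(z_n), where Λ(a) = (Λ_1 + a,…,Λ_N + a)). Then an M-valued holomorphic function g on an open subset of ℂ∖{z_1,…,z_n} satisfies D_{K,M}(u,∂) g = 0 if and only if the function C(u)g(u) satisfies D'(u,∂)(C·g) = 0. -/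
noncomputable section

namespace GaudinModel

section Twist

variable {N n : ℕ}
variable (V : Fin n → Type*) [∀ i, AddCommGroup (V i)] [∀ i, Module ℂ (V i)]
  (M : Type*) [NormedAddCommGroup M] [NormedSpace ℂ M]
  (E : ∀ i : Fin n, Fin N → Fin N → (V i →ₗ[ℂ] V i))
  (φ : M ≃ₗ[ℂ] PiTensorProduct ℂ V)
  (z : Fin n → ℂ) (K : Matrix (Fin N) (Fin N) ℂ) (a : Fin n → ℕ)

/-- The operator `X_{bc}(u,∂)` with each `e_{cb}^{(j)}` replaced by
`e_{cb}^{(j)} + a_j δ_{bc}`: a building block of the universal differential operator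
associated with `K` and the twisted module `M_{Λ^{(1)}(a_1)}(z_1) ⊗ ⋯ ⊗ M_{Λ^{(n)}(a_n)}(z_n)`. -/
def XgTw (b c : Fin N) (f : ℂ → M) : ℂ → M :=
  fun u => (if b = c then deriv f u else 0) - K b c • f u
    - ∑ j : Fin n, (u - z j)⁻¹ •
        ((EE V M E φ j c b) (f u) + (if b = c then (a j : ℂ) • f u else 0))

/-- The universal differential operator with each `e_{ba}^{(j)}` replaced by
`e_{ba}^{(j)} + a_j δ_{ab}`. -/
def DgTw (f : ℂ → M) : ℂ → M :=
  fun u => ∑ σ : Equiv.Perm (Fin N),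
    ((Equiv.Perm.sign σ : ℤˣ) : ℤ) •
      (((List.ofFn fun b : Fin N => XgTw V M E φ z K a b (σ b)).foldr (· ∘ ·) id) f u)

end Twist

section Helpers

variable {N n : ℕ}
variable (V : Fin n → Type*) [∀ i, AddCommGroup (V i)] [∀ i, Module ℂ (V i)]
  (M : Type*) [NormedAddCommGroup M] [NormedSpace ℂ M] [FiniteDimensional ℂ M]
  (E : ∀ i : Fin n, Fin N → Fin N → (V i →ₗ[ℂ] V i))
  (φ : M ≃ₗ[ℂ] PiTensorProduct ℂ V)
  (z : Fin n → ℂ) (K : Matrix (Fin N) (Fin N) ℂ) (a : Fin n → ℕ)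

/-- `C' = C · ∑_j a_j / (u - z_j)` away from the `z_j`. -/
lemma hasDerivAt_C (C : ℂ → ℂ) (hC : ∀ u : ℂ, C u = ∏ j : Fin n, (u - z j) ^ (a j))
    (u : ℂ) (hu : ∀ j, u ≠ z j) :
    HasDerivAt C (C u * ∑ j : Fin n, (u - z j)⁻¹ * (a j : ℂ)) u := by
  have hC' : C = fun u => ∏ j : Fin n, (u - z j) ^ (a j) := funext hC
  have hd : ∀ j : Fin n, DifferentiableAt ℂ (fun u : ℂ => (u - z j) ^ (a j)) u :=
    fun j => by fun_prop
  have hne : ∀ j : Fin n, (u - z j) ^ (a j) ≠ 0 := fun j => pow_ne_zero _ (sub_ne_zero.2 (hu j))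
  have hCd : DifferentiableAt ℂ C u := by rw [hC']; fun_prop
  have hCne : C u ≠ 0 := by
    rw [hC]; exact Finset.prod_ne_zero_iff.2 fun j _ => hne j
  have hlog : logDeriv C u = ∑ j : Fin n, (u - z j)⁻¹ * (a j : ℂ) := by
    rw [hC', logDeriv_prod (fun j _ => hne j) (fun j _ => hd j)]
    refine Finset.sum_congr rfl fun j _ => ?_
    rw [logDeriv_fun_pow (by fun_prop)]
    simp [logDeriv_apply, mul_comm]
  have := hCd.hasDerivAt
  rwa [← hlog, logDeriv_apply, mul_div_cancel₀ _ hCne]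

/-- `X_{bc}` preserves holomorphy on `U`. -/
lemma Xg_differentiableOn (U : Set ℂ) (hU : IsOpen U) (hUz : ∀ j, z j ∉ U)
    (b c : Fin N) (h : ℂ → M) (hh : DifferentiableOn ℂ h U) :
    DifferentiableOn ℂ (Xg V M E φ z K b c h) U := by
  haveI : CompleteSpace M := FiniteDimensional.complete ℂ M
  unfold Xg
  refine (DifferentiableOn.sub ?_ (hh.const_smul _)).sub ?_
  · by_cases hbc : b = c
    · simpa [hbc] using hh.deriv hU
    · simp [hbc]
  · refine DifferentiableOn.fun_sum fun j _ => DifferentiableOn.smul ?_ ?_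
    · refine DifferentiableOn.inv (by fun_prop) fun u hu => sub_ne_zero.2 ?_
      rintro rfl
      exact hUz j hu
    · exact (LinearMap.toContinuousLinearMap (EE V M E φ j c b)).differentiable.comp_differentiableOn hh

/-- The intertwining relation `X'_{bc} C = C X_{bc}`. -/
lemma XgTw_smul (C : ℂ → ℂ) (hC : ∀ u : ℂ, C u = ∏ j : Fin n, (u - z j) ^ (a j))
    (U : Set ℂ) (hU : IsOpen U) (hUz : ∀ j, z j ∉ U)
    (b c : Fin N) (h f : ℂ → M) (hh : DifferentiableOn ℂ h U)
    (hf : ∀ u ∈ U, f u = C u • h u) (u : ℂ) (hu : u ∈ U) :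
    XgTw V M E φ z K a b c f u = C u • Xg V M E φ z K b c h u := by
  have hne : ∀ j, u ≠ z j := fun j hj => hUz j (hj ▸ hu)
  have hd : deriv f u = C u • deriv h u + (C u * ∑ j : Fin n, (u - z j)⁻¹ * (a j : ℂ)) • h u := by
    have hev : f =ᶠ[nhds u] fun u => C u • h u :=
      Filter.eventually_of_mem (hU.mem_nhds hu) hf
    rw [hev.deriv_eq]
    exact ((hasDerivAt_C z a C hC u hne).smul
      ((hh.differentiableAt (hU.mem_nhds hu)).hasDerivAt)).deriv
  unfold XgTw Xg
  rw [hf u hu, hd]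
  have h1 : ∑ j : Fin n, (u - z j)⁻¹ • (EE V M E φ j c b) (C u • h u)
      = C u • ∑ j : Fin n, (u - z j)⁻¹ • (EE V M E φ j c b) (h u) := by
    rw [Finset.smul_sum]
    refine Finset.sum_congr rfl fun j _ => ?_
    rw [map_smul, smul_comm]
  by_cases hbc : b = c
  · simp only [hbc, if_true, smul_add, Finset.sum_add_distrib] at h1 ⊢
    rw [h1]
    have h2 : ∑ j : Fin n, (u - z j)⁻¹ • (a j : ℂ) • C u • h u
        = (C u * ∑ j : Fin n, (u - z j)⁻¹ * (a j : ℂ)) • h u := by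
      rw [Finset.mul_sum, Finset.sum_smul]
      refine Finset.sum_congr rfl fun j _ => ?_
      simp only [smul_smul]
      congr 1
      ring
    rw [h2, smul_sub, smul_sub, smul_comm (C u) (K c c)]
    abel
  · simp only [hbc, if_false, add_zero]
    rw [h1, smul_sub, smul_sub, smul_comm (C u) (K b c), smul_zero]

/-- Iterated intertwining relation along a list of index pairs. -/
lemma foldr_smul (C : ℂ → ℂ) (hC : ∀ u : ℂ, C u = ∏ j : Fin n, (u - z j) ^ (a j))
    (U : Set ℂ) (hU : IsOpen U) (hUz : ∀ j, z j ∉ U)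
    (g : ℂ → M) (hg : DifferentiableOn ℂ g U) (l : List (Fin N × Fin N)) :
    DifferentiableOn ℂ (((l.map fun p => Xg V M E φ z K p.1 p.2).foldr (· ∘ ·) id) g) U ∧
    ∀ u ∈ U, ((l.map fun p => XgTw V M E φ z K a p.1 p.2).foldr (· ∘ ·) id)
        (fun x => C x • g x) u
      = C u • ((l.map fun p => Xg V M E φ z K p.1 p.2).foldr (· ∘ ·) id) g u := by
  induction l with
  | nil => exact ⟨hg, fun u _ => rfl⟩
  | cons p l ih =>
    exact ⟨Xg_differentiableOn V M E φ z K U hU hUz p.1 p.2 _ ih.1,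
      XgTw_smul V M E φ z K a C hC U hU hUz p.1 p.2 _ _ ih.1 ih.2⟩

end Helpers

/-- comparison theorem for the Gaudin model.  Let `a_1, …, a_n` be
nonnegative integers and `C(u) = ∏_j (u − z_j)^{a_j}`.  An `M`-valued holomorphic function
`g` on an open subset `U ⊆ ℂ∖{z_1,…,z_n}` satisfies `D_{K,M}(u,∂) g = 0` on `U` if and only
if `C·g` satisfies `D'(u,∂)(C·g) = 0` on `U`, where `D'` is the universal differential
operator with each `e_{ba}^{(j)}` replaced by `e_{ba}^{(j)} + a_j δ_{ab}`. -/
theorem statement_15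
    {N n : ℕ} (hN : 2 ≤ N) (hn : 1 ≤ n)
    (V : Fin n → Type*) [∀ i, AddCommGroup (V i)] [∀ i, Module ℂ (V i)]
    [∀ i, FiniteDimensional ℂ (V i)]
    (M : Type*) [NormedAddCommGroup M] [NormedSpace ℂ M] [FiniteDimensional ℂ M]
    (Λ : Fin n → Fin N → ℤ)
    (hdom : ∀ i, ∀ a b : Fin N, a ≤ b → Λ i b ≤ Λ i a)
    (hpoly : ∀ i a, 0 ≤ Λ i a)
    (E : ∀ i : Fin n, Fin N → Fin N → (V i →ₗ[ℂ] V i))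
    (hrel : GlRel V E)
    (hhw : IsHW V E Λ)
    (φ : M ≃ₗ[ℂ] PiTensorProduct ℂ V)
    (z : Fin n → ℂ) (hz : Function.Injective z)
    (K : Matrix (Fin N) (Fin N) ℂ)
    (a : Fin n → ℕ)
    (C : ℂ → ℂ) (hC : ∀ u : ℂ, C u = ∏ j : Fin n, (u - z j) ^ (a j))
    (U : Set ℂ) (hU : IsOpen U) (hUz : ∀ j, z j ∉ U)
    (g : ℂ → M) (hg : DifferentiableOn ℂ g U) :
    (∀ u ∈ U, Dg V M E φ z K g u = 0) ↔
    (∀ u ∈ U, DgTw V M E φ z K a (fun x => C x • g x) u = 0) := by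
  have key : ∀ u ∈ U, DgTw V M E φ z K a (fun x => C x • g x) u
      = C u • Dg V M E φ z K g u := by
    intro u hu
    unfold DgTw Dg
    rw [Finset.smul_sum]
    refine Finset.sum_congr rfl fun σ _ => ?_
    have h := (foldr_smul V M E φ z K a C hC U hU hUz g hg
      (List.ofFn fun b : Fin N => (b, σ b))).2 u hu
    simp only [List.map_ofFn] at h
    rw [smul_comm]
    exact congrArg _ h
  have hCne : ∀ u ∈ U, C u ≠ 0 := by
    intro u hu
    rw [hC]
    refine Finset.prod_ne_zero_iff.2 fun j _ => pow_ne_zero _ (sub_ne_zero.2 ?_)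
    rintro rfl
    exact hUz j hu
  refine forall₂_congr fun u hu => ?_
  rw [key u hu, smul_eq_zero_iff_right (hCne u hu)]

end GaudinModel
end
end
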